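/- arXiv:1708.02855 — 7 statements merged into one kernel-verified Lean document; each statement's English description precedes it below -/
import Mathlib

section
/- Let X and Y be two generalized Peano continua, and assume that G is a finitely generated group acting properly and cocompactly by homeomorphisms on both X and Y. Then Ends(X) is homeomorphic to Ends(Y). -/
open Set Pointwise

/-- A generalized Peano continuum: a connected, locally compact, locally connected,
σ-compact, metrizable topological space. -/
structure IsGenPeanoContinuum (X : Type*) [TopologicalSpace X] : Prop where
  connectedSpace : ConnectedSpace X
  locallyCompactSpace : LocallyCompactSpace X
  locallyConnectedSpace : LocallyConnectedSpace X
  sigmaCompactSpace : SigmaCompactSpace X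
  metrizableSpace : TopologicalSpace.MetrizableSpace X

/-- An exhaustion of a space by compact sets. -/
structure IsExhaustion {X : Type*} [TopologicalSpace X] (C : ℕ → Set X) : Prop where
  isCompact : ∀ i, IsCompact (C i)
  subset_interior : ∀ i, C i ⊆ interior (C (i + 1))
  iUnion_eq : (⋃ i, C i) = Set.univ

/-- The space of ends of `X` with respect to the exhaustion `C`: the inverse limit of the
sets of connected components of the complements `X ∖ C i`, the bonding maps being induced
by inclusion. -/
def EndsSpace {X : Type*} [TopologicalSpace X] (C : ℕ → Set X) : Type _ :=
  { E : ℕ → Set X //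
      (∀ i, ∃ x ∈ (C i)ᶜ, E i = connectedComponentIn (C i)ᶜ x) ∧
        ∀ i, E (i + 1) ⊆ E i }

/-- `EndsSpace C` is topologized as a subspace of the product of the discrete spaces of
components. -/
instance EndsSpace.instTopologicalSpace {X : Type*} [TopologicalSpace X] (C : ℕ → Set X) :
    TopologicalSpace (EndsSpace C) :=
  TopologicalSpace.induced (fun E => (E.1 : ℕ → Set X))
    (@Pi.topologicalSpace ℕ (fun _ => Set X) fun _ => ⊥)

/-- `G` acts on `X` by homeomorphisms. -/
def ContinuousActionOn (G X : Type*) [Group G] [TopologicalSpace X] [MulAction G X] : Prop :=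
  ∀ g : G, Continuous fun x : X => g • x

/-- The action of `G` on `X` is proper: for every compact `K`, only finitely many translates
of `K` meet `K`. -/
def ProperActionOn (G X : Type*) [Group G] [TopologicalSpace X] [MulAction G X] : Prop :=
  ∀ K : Set X, IsCompact K → {g : G | ((g • K) ∩ K).Nonempty}.Finite

/-- The action of `G` on `X` is cocompact: the translates of some compact set cover `X`. -/
def CocompactActionOn (G X : Type*) [Group G] [TopologicalSpace X] [MulAction G X] : Prop :=
  ∃ K : Set X, IsCompact K ∧ (⋃ g : G, g • K) = Set.univ

theorem IsExhaustion.monotone {X : Type*} [TopologicalSpace X] {C : ℕ → Set X}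
    (hC : IsExhaustion C) : Monotone C :=
  monotone_nat_of_le_succ fun i => (hC.subset_interior i).trans interior_subset

/-- Every compact set is contained in some member of an exhaustion. -/
theorem IsExhaustion.exists_subset {X : Type*} [TopologicalSpace X] {C : ℕ → Set X}
    (hC : IsExhaustion C) {K : Set X} (hK : IsCompact K) : ∃ i, K ⊆ C i := by
  obtain ⟨i, hi⟩ := hK.elim_directed_cover (fun i => interior (C i))
    (fun _ => isOpen_interior)
    (fun x _ => by
      have hx : x ∈ ⋃ i, C i := hC.iUnion_eq ▸ mem_univ x
      obtain ⟨i, hi⟩ := mem_iUnion.1 hx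
      exact mem_iUnion.2 ⟨i + 1, hC.subset_interior i hi⟩)
    (Monotone.directed_le fun _ _ h => interior_mono (hC.monotone h))
  exact ⟨i, hi.trans interior_subset⟩

/-- In a connected, locally connected, locally compact Hausdorff space, every compact set lies
in a compact connected set. -/
theorem IsCompact.exists_isCompact_isPreconnected_superset {X : Type*} [TopologicalSpace X]
    [T2Space X] [ConnectedSpace X] [LocallyConnectedSpace X] [LocallyCompactSpace X]
    {K : Set X} (hK : IsCompact K) : ∃ L, IsCompact L ∧ IsPreconnected L ∧ K ⊆ L := by
  have hloc : ∀ x : X, ∃ V ∈ nhds x, ∃ L, IsCompact L ∧ IsPreconnected L ∧ V ⊆ L := by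
    intro x
    obtain ⟨N, hN, hxN⟩ := exists_compact_mem_nhds x
    obtain ⟨V, hVN, hVo, hxV, hVc⟩ :=
      locallyConnectedSpace_iff_subsets_isOpen_isConnected.1 inferInstance x N hxN
    exact ⟨V, hVo.mem_nhds hxV, closure V, hN.of_isClosed_subset isClosed_closure
      (closure_minimal hVN hN.isClosed), hVc.isPreconnected.closure, subset_closure⟩
  have hpair : ∀ x y : X, ∃ L, IsCompact L ∧ IsPreconnected L ∧ x ∈ L ∧ y ∈ L := by
    intro x
    let S : Set X := {y | ∃ L, IsCompact L ∧ IsPreconnected L ∧ x ∈ L ∧ y ∈ L}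
    have hjoin : ∀ {y z : X} {L : Set X}, IsCompact L → IsPreconnected L → y ∈ L → z ∈ L →
        y ∈ S → z ∈ S := by
      rintro y z L hLc hLp hy hz ⟨M, hMc, hMp, hxM, hyM⟩
      exact ⟨M ∪ L, hMc.union hLc, hMp.union y hyM hy hLp, Or.inl hxM, Or.inr hz⟩
    have hopen : IsOpen S := isOpen_iff_mem_nhds.2 fun y hy => by
      obtain ⟨V, hV, L, hLc, hLp, hVL⟩ := hloc y
      exact Filter.mem_of_superset hV fun z hz =>
        hjoin hLc hLp (hVL (mem_of_mem_nhds hV)) (hVL hz) hy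
    have hclosed : IsClosed S := by
      refine isOpen_compl_iff.1 (isOpen_iff_mem_nhds.2 fun y hy => ?_)
      obtain ⟨V, hV, L, hLc, hLp, hVL⟩ := hloc y
      exact Filter.mem_of_superset hV fun z hz hzS =>
        hy (hjoin hLc hLp (hVL hz) (hVL (mem_of_mem_nhds hV)) hzS)
    have hx : x ∈ S := ⟨{x}, isCompact_singleton, isPreconnected_singleton, rfl, rfl⟩
    have hS : S = univ := IsClopen.eq_univ ⟨hclosed, hopen⟩ ⟨x, hx⟩
    exact fun y => (hS ▸ mem_univ y : y ∈ S)
  refine hK.induction_on (p := fun K => ∃ L, IsCompact L ∧ IsPreconnected L ∧ K ⊆ L)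
    ⟨∅, isCompact_empty, isPreconnected_empty, Subset.rfl⟩
    (fun s t hst ⟨L, h₁, h₂, h₃⟩ => ⟨L, h₁, h₂, hst.trans h₃⟩) ?_ ?_
  · rintro s t ⟨L, hLc, hLp, hL⟩ ⟨M, hMc, hMp, hM⟩
    rcases L.eq_empty_or_nonempty with rfl | ⟨x, hx⟩
    · exact ⟨M, hMc, hMp, union_subset (hL.trans (empty_subset _)) hM⟩
    rcases M.eq_empty_or_nonempty with rfl | ⟨y, hy⟩
    · exact ⟨L, hLc, hLp, union_subset hL (hM.trans (empty_subset _))⟩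
    obtain ⟨P, hPc, hPp, hxP, hyP⟩ := hpair x y
    exact ⟨(L ∪ P) ∪ M, (hLc.union hPc).union hMc,
      (hLp.union x hx hxP hPp).union y (Or.inr hyP) hy hMp,
      union_subset (hL.trans fun _ h => Or.inl (Or.inl h)) (hM.trans fun _ h => Or.inr h)⟩
  · intro x _
    obtain ⟨V, hV, h⟩ := hloc x
    exact ⟨V, mem_nhdsWithin_of_mem_nhds hV, h⟩

/-- For a proper action, only finitely many translates of a compact set meet another one. -/
theorem ProperActionOn.finite_inter {G X : Type*} [Group G] [TopologicalSpace X] [MulAction G X]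
    (h : ProperActionOn G X) {K L : Set X} (hK : IsCompact K) (hL : IsCompact L) :
    {g : G | ((g • K) ∩ L).Nonempty}.Finite :=
  (h (K ∪ L) (hK.union hL)).subset fun _ hg => hg.mono
    (inter_subset_inter (smul_set_mono subset_union_left) subset_union_right)

/-- Translates of `L` indexed by the translates of `K` meeting a connected set far out in `X`
all lie in one component of the complement of a given compact set `D` of `Y`. -/
theorem exists_isCompact_forall_mem_connectedComponentIn
    {G X Y : Type*} [Group G] [TopologicalSpace X] [TopologicalSpace Y]
    [MulAction G X] [MulAction G Y]
    (hX : IsGenPeanoContinuum X) (hY : IsGenPeanoContinuum Y)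
    (hXcont : ContinuousActionOn G X) (hYcont : ContinuousActionOn G Y)
    (hXproper : ProperActionOn G X) (hYproper : ProperActionOn G Y)
    {K : Set X} (hK : IsCompact K) (hKcov : (⋃ g : G, g • K) = univ)
    {L : Set Y} (hL : IsCompact L) (hLne : L.Nonempty) {D : Set Y} (hD : IsCompact D) :
    ∃ C : Set X, IsCompact C ∧ ∀ U : Set X, IsPreconnected U → U ⊆ Cᶜ →
      ∀ g h : G, ((g • K) ∩ U).Nonempty → ((h • K) ∩ U).Nonempty →
        ∀ y ∈ g • L, ∀ z ∈ h • L, y ∈ Dᶜ ∧ z ∈ connectedComponentIn Dᶜ y := by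
  have := hX.locallyCompactSpace
  have := hY.locallyCompactSpace
  have := hY.connectedSpace
  have := hY.locallyConnectedSpace
  have := hY.metrizableSpace
  obtain ⟨K', hK', hKK'⟩ := exists_compact_superset hK
  obtain ⟨y₀, hy₀⟩ := hLne
  have hSfin := hXproper K' hK'
  obtain ⟨L', hL', hL'p, hLL'⟩ := (hL.union
    (hSfin.image fun s : G => s • y₀).isCompact).exists_isCompact_isPreconnected_superset
  have hmeet : ∀ s : G, ((s • K') ∩ K').Nonempty → s • y₀ ∈ L' := fun s hs =>
    hLL' (Or.inr ⟨s, hs, rfl⟩)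
  have hbad := hYproper.finite_inter hL' hD
  refine ⟨⋃ g ∈ {g : G | ((g • L') ∩ D).Nonempty}, g • K', hbad.isCompact_biUnion
    fun g _ => hK'.image (hXcont g), fun U hU hUC => ?_⟩
  have hgood : ∀ g : G, ∀ x ∈ g • K', x ∈ U → g • L' ⊆ Dᶜ := by
    intro g x hx hxU y hy hyD
    exact hUC hxU (mem_biUnion (show g ∈ {g : G | ((g • L') ∩ D).Nonempty} from ⟨y, hy, hyD⟩) hx)
  have hconn : ∀ g : G, IsPreconnected (g • L') := fun g =>
    hL'p.image _ (hYcont g).continuousOn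
  have hy₀' : y₀ ∈ L' := hLL' (Or.inl hy₀)
  have hmem : ∀ g : G, g • y₀ ∈ g • L' := fun g => smul_mem_smul_set hy₀'
  have hsame : ∀ g h : G, ∀ x ∈ U, x ∈ g • K' → x ∈ h • K' →
      connectedComponentIn Dᶜ (g • y₀) = connectedComponentIn Dᶜ (h • y₀) := by
    intro g h x hxU hxg hxh
    refine connectedComponentIn_eq
      ((hconn g).subset_connectedComponentIn (hmem g) (hgood g x hxg hxU) ?_)
    rw [mem_smul_set_iff_inv_smul_mem, smul_smul]
    refine hmeet _ ⟨g⁻¹ • x, ?_, mem_smul_set_iff_inv_smul_mem.1 hxg⟩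
    rw [mem_smul_set_iff_inv_smul_mem, smul_smul]
    simpa using mem_smul_set_iff_inv_smul_mem.1 hxh
  have hcov : ∀ x : X, ∃ g : G, x ∈ g • K := fun x => mem_iUnion.1 (hKcov ▸ mem_univ x)
  choose γ hγ using hcov
  have hKsub : ∀ g : G, g • K ⊆ g • K' := fun g =>
    smul_set_mono (hKK'.trans interior_subset)
  have hconst : ∀ x ∈ U, ∀ x' ∈ U, connectedComponentIn Dᶜ (γ x • y₀) =
      connectedComponentIn Dᶜ (γ x' • y₀) := by
    let : TopologicalSpace (Set Y) := ⊥
    have : DiscreteTopology (Set Y) := ⟨rfl⟩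
    intro x hx x' hx'
    refine hU.constant (f := fun x => connectedComponentIn Dᶜ (γ x • y₀)) ?_ hx hx'
    intro x hx
    refine continuousWithinAt_const.congr_of_eventuallyEq_of_mem
      (f := fun _ => connectedComponentIn Dᶜ (γ x • y₀)) ?_ hx
    have hnhds : (fun z : X => (γ x)⁻¹ • z) ⁻¹' interior K' ∈ nhds x :=
      (isOpen_interior.preimage (hXcont _)).mem_nhds
        (hKK' (mem_smul_set_iff_inv_smul_mem.1 (hγ x)))
    filter_upwards [mem_nhdsWithin_of_mem_nhds hnhds, self_mem_nhdsWithin] with z hz hzU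
    exact hsame _ _ z hzU (hKsub _ (hγ z))
      (mem_smul_set_iff_inv_smul_mem.2 (interior_subset hz))
  rintro g h ⟨x, hxg, hxU⟩ ⟨x', hxh, hxU'⟩ y hy z hz
  have hsub : ∀ g : G, g • L ⊆ g • L' := fun g =>
    smul_set_mono (subset_union_left.trans hLL')
  have hgD := hgood g x (hKsub _ hxg) hxU
  have hhD := hgood h x' (hKsub _ hxh) hxU'
  refine ⟨hgD (hsub g hy), ?_⟩
  have h₁ : connectedComponentIn Dᶜ y = connectedComponentIn Dᶜ (g • y₀) :=
    connectedComponentIn_eq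
      ((hconn g).subset_connectedComponentIn (hsub g hy) hgD (hmem g))
  rw [h₁, hsame g _ x hxU (hKsub _ hxg) (hKsub _ (hγ x)), hconst x hxU x' hxU',
    hsame _ h x' hxU' (hKsub _ (hγ x')) (hKsub _ hxh)]
  exact (hconn h).subset_connectedComponentIn (hmem h) hhD (hsub h hz)

namespace EndsSpace

theorem nonempty {X : Type*} [TopologicalSpace X] {C : ℕ → Set X} (E : EndsSpace C) (i : ℕ) :
    (E.1 i).Nonempty := by
  obtain ⟨x, hx, h⟩ := E.2.1 i
  exact ⟨x, h ▸ mem_connectedComponentIn hx⟩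

theorem isPreconnected {X : Type*} [TopologicalSpace X] {C : ℕ → Set X} (E : EndsSpace C)
    (i : ℕ) : IsPreconnected (E.1 i) := by
  obtain ⟨x, _, h⟩ := E.2.1 i
  exact h ▸ isPreconnected_connectedComponentIn

theorem subset_compl {X : Type*} [TopologicalSpace X] {C : ℕ → Set X} (E : EndsSpace C)
    (i : ℕ) : E.1 i ⊆ (C i)ᶜ := by
  obtain ⟨x, _, h⟩ := E.2.1 i
  exact h ▸ connectedComponentIn_subset _ _

theorem eq_of_mem {X : Type*} [TopologicalSpace X] {C : ℕ → Set X} (E : EndsSpace C)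
    {i : ℕ} {x : X} (hx : x ∈ E.1 i) : E.1 i = connectedComponentIn (C i)ᶜ x := by
  obtain ⟨y, _, h⟩ := E.2.1 i
  rw [h] at hx ⊢
  exact connectedComponentIn_eq hx

theorem antitone {X : Type*} [TopologicalSpace X] {C : ℕ → Set X} (E : EndsSpace C) :
    Antitone E.1 :=
  antitone_nat_of_succ_le E.2.2

/-- A map between end spaces is continuous if each coordinate of the image depends on only one
coordinate of the argument. -/
theorem continuous_of_forall_exists {X Y : Type*} [TopologicalSpace X] [TopologicalSpace Y]
    {C : ℕ → Set X} {D : ℕ → Set Y} {f : EndsSpace C → EndsSpace D}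
    (hf : ∀ j, ∃ i, ∀ E E' : EndsSpace C, E.1 i = E'.1 i → (f E).1 j = (f E').1 j) :
    Continuous f := by
  let : TopologicalSpace (Set X) := ⊥
  have : DiscreteTopology (Set X) := ⟨rfl⟩
  let : TopologicalSpace (Set Y) := ⊥
  refine continuous_induced_rng.2 (continuous_pi fun j => ?_)
  obtain ⟨i, hi⟩ := hf j
  have hev : Continuous fun E : EndsSpace C => E.1 i :=
    (continuous_apply i).comp continuous_induced_dom
  refine continuous_iff_continuousAt.2 fun E => ?_
  refine continuousAt_const.congr (f := fun _ => (f E).1 j) ?_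
  filter_upwards [((isOpen_discrete {E.1 i}).preimage hev).mem_nhds rfl] with E' heq
  exact hi _ _ (Eq.symm heq)

/-- Ends `E` of `X` and `F` of `Y` correspond if arbitrarily far out there are group elements
moving `K` to meet `E` and `L` to meet `F`. -/
def Corresponds (G : Type*) {X Y : Type*} [Group G] [TopologicalSpace X] [TopologicalSpace Y]
    [MulAction G X] [MulAction G Y] {C : ℕ → Set X} {D : ℕ → Set Y} (K : Set X) (L : Set Y)
    (E : EndsSpace C) (F : EndsSpace D) : Prop :=
  ∀ i j, ∃ g : G, ((g • K) ∩ E.1 i).Nonempty ∧ ((g • L) ∩ F.1 j).Nonempty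

theorem Corresponds.symm {G X Y : Type*} [Group G] [TopologicalSpace X] [TopologicalSpace Y]
    [MulAction G X] [MulAction G Y] {C : ℕ → Set X} {D : ℕ → Set Y} {K : Set X} {L : Set Y}
    {E : EndsSpace C} {F : EndsSpace D} (h : Corresponds G K L E F) : Corresponds G L K F E :=
  fun j i => (h i j).imp fun _ => And.symm

/-- The correspondence of ends is the graph of a continuous map. -/
theorem exists_continuous_corresponds
    {G X Y : Type*} [Group G] [TopologicalSpace X] [TopologicalSpace Y]
    [MulAction G X] [MulAction G Y]
    (hX : IsGenPeanoContinuum X) (hY : IsGenPeanoContinuum Y)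
    (hXcont : ContinuousActionOn G X) (hYcont : ContinuousActionOn G Y)
    (hXproper : ProperActionOn G X) (hYproper : ProperActionOn G Y)
    {K : Set X} (hK : IsCompact K) (hKcov : (⋃ g : G, g • K) = univ)
    {L : Set Y} (hL : IsCompact L) (hLne : L.Nonempty)
    {C : ℕ → Set X} (hC : IsExhaustion C) {D : ℕ → Set Y} (hD : IsExhaustion D) :
    ∃ f : EndsSpace C → EndsSpace D, Continuous f ∧
      ∀ E F, Corresponds G K L E F ↔ f E = F := by
  have key : ∀ j, ∃ i, ∀ U : Set X, IsPreconnected U → U ⊆ (C i)ᶜ →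
      ∀ g h : G, ((g • K) ∩ U).Nonempty → ((h • K) ∩ U).Nonempty →
        ∀ y ∈ g • L, ∀ z ∈ h • L, y ∈ (D j)ᶜ ∧ z ∈ connectedComponentIn (D j)ᶜ y := by
    intro j
    obtain ⟨B, hB, h⟩ := exists_isCompact_forall_mem_connectedComponentIn hX hY hXcont hYcont
      hXproper hYproper hK hKcov hL hLne (hD.isCompact j)
    obtain ⟨i, hi⟩ := hC.exists_subset hB
    exact ⟨i, fun U hU hUC => h U hU (hUC.trans (compl_subset_compl.2 hi))⟩
  choose ι hι using key
  have hdet : ∀ j, ∀ E E' : EndsSpace C, ∀ F F' : EndsSpace D, E.1 (ι j) = E'.1 (ι j) →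
      Corresponds G K L E F → Corresponds G K L E' F' → F.1 j = F'.1 j := by
    intro j E E' F F' hEE' hF hF'
    obtain ⟨g, hg, y, hyL, hyF⟩ := hF (ι j) j
    obtain ⟨h, hh, z, hzL, hzF⟩ := hF' (ι j) j
    have hyz := hι j _ (E.isPreconnected _) (E.subset_compl _) g h hg (hEE' ▸ hh) y hyL z hzL
    rw [F.eq_of_mem hyF, F'.eq_of_mem hzF]
    exact connectedComponentIn_eq hyz.2
  have hex : ∀ E : EndsSpace C, ∃ F : EndsSpace D, Corresponds G K L E F := by
    intro E
    have hmeet : ∀ i, ∃ g : G, ((g • K) ∩ E.1 i).Nonempty := by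
      intro i
      obtain ⟨x, hx⟩ := E.nonempty i
      obtain ⟨g, hg⟩ := mem_iUnion.1 (hKcov ▸ mem_univ x : x ∈ ⋃ g : G, g • K)
      exact ⟨g, x, hg, hx⟩
    choose γ hγ using hmeet
    obtain ⟨y₀, hy₀⟩ := hLne
    have hmem : ∀ g : G, g • y₀ ∈ g • L := fun g => smul_mem_smul_set hy₀
    have hV : ∀ j, ∀ h : G, ((h • K) ∩ E.1 (ι j)).Nonempty →
        γ (ι j) • y₀ ∈ (D j)ᶜ ∧ h • y₀ ∈ connectedComponentIn (D j)ᶜ (γ (ι j) • y₀) :=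
      fun j h hh => hι j _ (E.isPreconnected _) (E.subset_compl _) _ h (hγ _) hh _ (hmem _) _
        (hmem h)
    refine ⟨⟨fun j => connectedComponentIn (D j)ᶜ (γ (ι j) • y₀),
      fun j => ⟨_, (hV j _ (hγ _)).1, rfl⟩, fun j => ?_⟩, fun i j => ?_⟩
    · have hh := hγ (max (ι j) (ι (j + 1)))
      have h₁ := (hV j _ (hh.mono (inter_subset_inter_right _
        (E.antitone (le_max_left _ _))))).2
      have h₂ := (hV (j + 1) _ (hh.mono (inter_subset_inter_right _
        (E.antitone (le_max_right _ _))))).2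
      beta_reduce
      rw [connectedComponentIn_eq h₁, connectedComponentIn_eq h₂]
      exact connectedComponentIn_mono _ (compl_subset_compl.2 (hD.monotone j.le_succ))
    · have hh := hγ (max i (ι j))
      exact ⟨_, hh.mono (inter_subset_inter_right _ (E.antitone (le_max_left _ _))), _, hmem _,
        (hV j _ (hh.mono (inter_subset_inter_right _ (E.antitone (le_max_right _ _))))).2⟩
  choose f hf using hex
  refine ⟨f, continuous_of_forall_exists fun j => ⟨ι j, fun E E' h =>
    hdet j E E' _ _ h (hf E) (hf E')⟩, fun E F => ⟨fun h => ?_, fun h => h ▸ hf E⟩⟩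
  exact Subtype.ext (funext fun j => hdet j E E _ _ rfl (hf E) h)

end EndsSpace

/-- If a finitely generated group `G` acts properly and cocompactly by
homeomorphisms on two generalized Peano continua `X` and `Y`, then `Ends(X)` is homeomorphic
to `Ends(Y)` (computed with respect to any exhaustions of `X` and `Y`). -/
theorem ends_homeomorph_of_proper_cocompact_actions
    {G X Y : Type*} [Group G] [TopologicalSpace X] [TopologicalSpace Y]
    [MulAction G X] [MulAction G Y]
    (hG : Group.FG G)
    (hX : IsGenPeanoContinuum X) (hY : IsGenPeanoContinuum Y)
    (hXcont : ContinuousActionOn G X) (hYcont : ContinuousActionOn G Y)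
    (hXproper : ProperActionOn G X) (hYproper : ProperActionOn G Y)
    (hXcocompact : CocompactActionOn G X) (hYcocompact : CocompactActionOn G Y)
    (C : ℕ → Set X) (hC : IsExhaustion C)
    (D : ℕ → Set Y) (hD : IsExhaustion D) :
    Nonempty (EndsSpace C ≃ₜ EndsSpace D) := by
  obtain ⟨K, hK, hKcov⟩ := hXcocompact
  obtain ⟨L, hL, hLcov⟩ := hYcocompact
  have := hX.connectedSpace
  have := hY.connectedSpace
  have hKne : K.Nonempty := by
    rw [nonempty_iff_ne_empty]
    rintro rfl
    exact empty_ne_univ (by simpa using hKcov)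
  have hLne : L.Nonempty := by
    rw [nonempty_iff_ne_empty]
    rintro rfl
    exact empty_ne_univ (by simpa using hLcov)
  obtain ⟨f, hfcont, hf⟩ := EndsSpace.exists_continuous_corresponds hX hY hXcont hYcont
    hXproper hYproper hK hKcov hL hLne hC hD
  obtain ⟨f', hfcont', hf'⟩ := EndsSpace.exists_continuous_corresponds hY hX hYcont hXcont
    hYproper hXproper hL hLcov hK hKne hD hC
  exact ⟨{
    toFun := f
    invFun := f'
    left_inv := fun E => (hf' _ _).1 ((hf E _).2 rfl).symm
    right_inv := fun F => (hf _ _).1 ((hf' F _).2 rfl).symm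
    continuous_toFun := hfcont
    continuous_invFun := hfcont' }⟩
end

section
/- If 𝒟 is an upper semi-continuous decomposition of a generalized Peano continuum X, then the decomposition space X/𝒟 is a generalized Peano continuum; in particular, X/𝒟 is connected, locally connected, locally compact, σ-compact, and metrizable. -/
open Set Pointwise

/-- A decomposition (partition) of `X` is encoded by a setoid `s`; the elements of the
decomposition are the equivalence classes `{y | s.r x y}`.  The saturation of a set `A` is
the union of `A` with all decomposition elements meeting `A`. -/
def decompSat {X : Type*} (s : Setoid X) (A : Set X) : Set X :=
  {x : X | ∃ a ∈ A, s.r x a}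

/-- The decomposition `s` of `X` is upper semi-continuous: every decomposition element is
closed and compact, and every open set `U` containing a decomposition element `D` contains
an open set `V` with `D ⊆ V ⊆ U` whose saturation lies in `U`. -/
structure IsUSCDecomposition {X : Type*} [TopologicalSpace X] (s : Setoid X) : Prop where
  isClosed : ∀ x : X, IsClosed {y | s.r x y}
  isCompact : ∀ x : X, IsCompact {y | s.r x y}
  shrink : ∀ (x : X) (U : Set X), IsOpen U → {y | s.r x y} ⊆ U →
    ∃ V : Set X, IsOpen V ∧ {y | s.r x y} ⊆ V ∧ V ⊆ U ∧ decompSat s V ⊆ U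

/-- The decomposition `s` is monotone: it is upper semi-continuous and each decomposition
element is connected. -/
def IsMonotoneUSCDecomposition {X : Type*} [TopologicalSpace X] (s : Setoid X) : Prop :=
  IsUSCDecomposition s ∧ ∀ x : X, IsConnected {y | s.r x y}

theorem IsProperMap.t2Space_of_surjective {X Y : Type*} [TopologicalSpace X] [TopologicalSpace Y]
    [T2Space X] {f : X → Y} (hf : IsProperMap f) (hsurj : Function.Surjective f) : T2Space Y := by
  refine ⟨fun y z hyz => ?_⟩
  have hdisj : Disjoint (f ⁻¹' {y}) (f ⁻¹' {z}) :=
    Disjoint.preimage f (disjoint_singleton.2 hyz)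
  obtain ⟨U, V, hU, hV, hyU, hzV, hUV⟩ :=
    SeparatedNhds.of_isCompact_isCompact (hf.isCompact_preimage isCompact_singleton)
      (hf.isCompact_preimage isCompact_singleton) hdisj
  refine ⟨kernImage f U, kernImage f V, isClosedMap_iff_kernImage.1 hf.isClosedMap hU,
    isClosedMap_iff_kernImage.1 hf.isClosedMap hV, fun x hx => hyU hx, fun x hx => hzV hx, ?_⟩
  refine Set.disjoint_left.2 fun w hw hw' => ?_
  obtain ⟨x, rfl⟩ := hsurj w
  exact Set.disjoint_left.1 hUV (hw rfl) (hw' rfl)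

theorem IsProperMap.weaklyLocallyCompactSpace_of_surjective {X Y : Type*} [TopologicalSpace X]
    [TopologicalSpace Y] [WeaklyLocallyCompactSpace X] {f : X → Y} (hf : IsProperMap f)
    (hsurj : Function.Surjective f) : WeaklyLocallyCompactSpace Y := by
  refine ⟨fun y => ?_⟩
  obtain ⟨K, hK, hyK⟩ :=
    exists_compact_superset (hf.isCompact_preimage (isCompact_singleton (x := y)))
  refine ⟨f '' K, hK.image hf.continuous, Filter.mem_of_superset
    ((isClosedMap_iff_kernImage.1 hf.isClosedMap isOpen_interior).mem_nhds
      (fun x hx => hyK hx)) fun w hw => ?_⟩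
  obtain ⟨x, rfl⟩ := hsurj w
  exact mem_image_of_mem f (interior_subset (hw rfl))

open TopologicalSpace in
theorem IsProperMap.secondCountableTopology_of_surjective {X Y : Type*} [TopologicalSpace X]
    [TopologicalSpace Y] [SecondCountableTopology X] {f : X → Y} (hf : IsProperMap f)
    (hsurj : Function.Surjective f) : SecondCountableTopology Y := by
  let B : Set (Set Y) :=
    (fun S : Set (Set X) => kernImage f (⋃₀ S)) '' {S | S.Finite ∧ S ⊆ countableBasis X}
  have hB : B.Countable := (Set.countable_ofPred_finite_subset (countable_countableBasis X)).image _
  refine (isTopologicalBasis_of_isOpen_of_nhds (s := B) ?_ ?_).secondCountableTopology hB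
  · rintro _ ⟨S, ⟨-, hS⟩, rfl⟩
    exact isClosedMap_iff_kernImage.1 hf.isClosedMap
      (isOpen_sUnion fun U hU => isOpen_of_mem_countableBasis (hS hU))
  · intro y W hyW hW
    have hWX : IsOpen (f ⁻¹' W) := hW.preimage hf.continuous
    obtain ⟨S, hS, hSfin, hcover⟩ :=
      (hf.isCompact_preimage (isCompact_singleton (x := y))).elim_finite_subcover_image
        (b := {U | U ∈ countableBasis X ∧ U ⊆ f ⁻¹' W}) (c := id)
        (fun U hU => isOpen_of_mem_countableBasis hU.1) (fun x hx => by
          have hxW : x ∈ f ⁻¹' W := by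
            rw [mem_preimage, show f x = y from hx]
            exact hyW
          obtain ⟨U, hU, hxU, hUW⟩ :=
            (isBasis_countableBasis X).exists_subset_of_mem_open hxW hWX
          exact mem_biUnion (show U ∈ {U | U ∈ countableBasis X ∧ U ⊆ f ⁻¹' W} from ⟨hU, hUW⟩) hxU)
    refine ⟨_, ⟨S, ⟨hSfin, fun U hU => (hS hU).1⟩, rfl⟩, fun x hx => ?_, fun w hw => ?_⟩
    · simpa [sUnion_eq_biUnion] using hcover hx
    · obtain ⟨x, rfl⟩ := hsurj w
      obtain ⟨U, hU, hxU⟩ := hw rfl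
      exact (hS hU).2 hxU

theorem IsUSCDecomposition.isProperMap_mk {X : Type*} [TopologicalSpace X] {s : Setoid X}
    (hs : IsUSCDecomposition s) : IsProperMap (Quotient.mk s) := by
  refine isProperMap_iff_isClosedMap_and_compact_fibers.2 ⟨continuous_quotient_mk', ?_, ?_⟩
  · refine isClosedMap_iff_kernImage.2 fun {U} hU => ?_
    refine isQuotientMap_quotient_mk'.isOpen_preimage.1 (isOpen_iff_forall_mem_open.2 fun x hx => ?_)
    obtain ⟨V, hV, hxV, -, hVU⟩ :=
      hs.shrink x U hU fun y hy => hx (Quotient.sound (s.symm hy))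
    exact ⟨V, fun v hv y hy => hVU ⟨v, hv, Quotient.exact hy⟩, hV, hxV (s.refl x)⟩
  · intro q
    obtain ⟨x, rfl⟩ := Quotient.exists_rep q
    convert hs.isCompact x using 1
    ext y
    exact ⟨fun h => s.symm (Quotient.exact h), fun h => Quotient.sound (s.symm h)⟩

/-- The decomposition space of an upper semi-continuous decomposition of a
generalized Peano continuum is a generalized Peano continuum (connected, locally connected,
locally compact, σ-compact and metrizable). -/
theorem decompositionSpace_isGenPeanoContinuum
    {X : Type*} [TopologicalSpace X]
    (hX : IsGenPeanoContinuum X)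
    (s : Setoid X) (hs : IsUSCDecomposition s) :
    IsGenPeanoContinuum (Quotient s) := by
  obtain ⟨_, _, _, _, _⟩ := hX
  have hsurj : Function.Surjective (Quotient.mk s) := Quotient.mk_surjective
  have hprop := hs.isProperMap_mk
  have : SecondCountableTopology X := by
    let := TopologicalSpace.metrizableSpaceMetric X
    exact EMetric.secondCountable_of_sigmaCompact X
  have := hprop.t2Space_of_surjective hsurj
  have := hprop.weaklyLocallyCompactSpace_of_surjective hsurj
  have := hprop.secondCountableTopology_of_surjective hsurj
  exact ⟨inferInstance, inferInstance, isQuotientMap_quotient_mk'.isCoinducing.locallyConnectedSpace,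
    inferInstance, inferInstance⟩
end

section
/- Let M be a compact metric space with at least two points, and let G be a group acting on M by homeomorphisms such that the induced action on the space Θ₂M of distinct unordered pairs of points of M is cocompact. Then there exist finite collections (Uᵢ)ᵢ₌₁,…,p and (Vᵢ)ᵢ₌₁,…,p of open subsets of M with closure(Uᵢ) ∩ closure(Vᵢ) = ∅ for every i, such that for any two distinct points x, y ∈ M there exist g ∈ G and i ∈ {1,…,p} with gx ∈ Uᵢ and gy ∈ Vᵢ. -/
open Set Pointwise

/-- The induced action of `G` on the space `Θ₂M` of distinct unordered pairs of points of
`M` is cocompact.  Unordered pairs are encoded as ordered pairs up to swapping: there is a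
compact set `K` of distinct ordered pairs such that every distinct pair can be translated
into `K` (in one of the two orders). -/
def CocompactOnDistinctPairs (G M : Type*) [Group G] [TopologicalSpace M]
    [MulAction G M] : Prop :=
  ∃ K : Set (M × M), IsCompact K ∧ (∀ p ∈ K, p.1 ≠ p.2) ∧
    ∀ x y : M, x ≠ y → ∃ g : G, (g • x, g • y) ∈ K ∨ (g • y, g • x) ∈ K

/-- A compact set of distinct ordered pairs is covered by finitely many products of open sets
with disjoint closures. -/
theorem IsCompact.exists_finset_separating_open_pairs {M : Type*} [TopologicalSpace M]
    [T25Space M] {K : Set (M × M)} (hK : IsCompact K) (hne : ∀ q ∈ K, q.1 ≠ q.2) :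
    ∃ (t : Finset (M × M)) (U V : M × M → Set M),
      (∀ q ∈ t, IsOpen (U q) ∧ IsOpen (V q) ∧ Disjoint (closure (U q)) (closure (V q))) ∧
      K ⊆ ⋃ q ∈ t, U q ×ˢ V q := by
  choose! U hxU hU V hyV hV hdisj using
    fun (q : M × M) (hq : q ∈ K) => exists_open_nhds_disjoint_closure (hne q hq)
  obtain ⟨t, htK, ht⟩ := hK.elim_nhds_subcover (fun q => U q ×ˢ V q) fun q hq =>
    ((hU q hq).prod (hV q hq)).mem_nhds ⟨hxU q hq, hyV q hq⟩
  exact ⟨t, U, V, fun q hq => ⟨hU q (htK q hq), hV q (htK q hq), hdisj q (htK q hq)⟩, ht⟩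

/-- Let `M` be a compact metric space with at least two points and let `G`
act on `M` by homeomorphisms so that the induced action on the space of distinct unordered
pairs is cocompact.  Then there are finite collections `U i`, `V i` of open subsets of `M`
with disjoint closures such that any two distinct points of `M` can be translated into some
pair `(U i, V i)`. -/
theorem exists_separating_open_pairs
    {G M : Type*} [Group G] [MetricSpace M] [CompactSpace M] [MulAction G M]
    (hcont : ContinuousActionOn G M)
    (hpts : ∃ a b : M, a ≠ b)
    (hcc : CocompactOnDistinctPairs G M) :
    ∃ (p : ℕ) (U V : Fin p → Set M),
      (∀ i, IsOpen (U i)) ∧ (∀ i, IsOpen (V i)) ∧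
      (∀ i, closure (U i) ∩ closure (V i) = ∅) ∧
      ∀ x y : M, x ≠ y → ∃ (g : G) (i : Fin p), g • x ∈ U i ∧ g • y ∈ V i := by
  obtain ⟨K, hK, hne, hcover⟩ := hcc
  obtain ⟨t, U, V, hUV, ht⟩ :=
    (hK.union (hK.image continuous_swap)).exists_finset_separating_open_pairs (by
      rintro q (hq | ⟨r, hr, rfl⟩)
      · exact hne q hq
      · exact (hne r hr).symm)
  let e := t.equivFin.symm
  refine ⟨t.card, fun i => U (e i), fun i => V (e i), fun i => (hUV _ (e i).2).1,
    fun i => (hUV _ (e i).2).2.1, fun i => (hUV _ (e i).2).2.2.inter_eq, fun x y hxy => ?_⟩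
  obtain ⟨g, hg⟩ := hcover x y hxy
  have hmem : (g • x, g • y) ∈ K ∪ Prod.swap '' K :=
    hg.imp id fun h => ⟨_, h, rfl⟩
  obtain ⟨q, hq, hx, hy⟩ := mem_iUnion₂.1 (ht hmem)
  exact ⟨g, t.equivFin ⟨q, hq⟩, by simpa [e] using hx, by simpa [e] using hy⟩
end

section
/- Let M be a Peano continuum with at least two points, and let G be a group acting on M as a convergence group such that the induced action on the space Θ₂M of distinct unordered pairs is cocompact. Then there exist finite collections (Uᵢ)ᵢ₌₁,…,p and (Vᵢ)ᵢ₌₁,…,p of open connected subsets of M with closure(Uᵢ) ∩ closure(Vᵢ) = ∅ for every i, such that if K ⊆ M is closed and x ∈ M ∖ K is a conical limit point, then there exist g ∈ G and i ∈ {1,…,p} with gx ∈ Uᵢ and gK ⊆ Vᵢ. -/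
open Set Pointwise

/-- The sequence `g` converges to `α` locally uniformly on `M ∖ {β}`: for every compact
`C ⊆ M ∖ {β}` and every open neighborhood `U` of `α` we eventually have `g i • C ⊆ U`. -/
def TendstoLocallyUniformlyAway {G M : Type*} [TopologicalSpace M] [SMul G M]
    (g : ℕ → G) (α β : M) : Prop :=
  ∀ C : Set M, IsCompact C → C ⊆ {β}ᶜ →
    ∀ U : Set M, IsOpen U → α ∈ U → ∃ N : ℕ, ∀ i : ℕ, N < i → (g i) • C ⊆ U

/-- The action of `G` on `M` is a convergence action: every sequence of distinct group
elements has a subsequence `g_{k_i}` and attracting/repelling points `α, β ∈ M` with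
`g_{k_i} → α` locally uniformly on `M ∖ {β}` and `g_{k_i}⁻¹ → β` locally uniformly on
`M ∖ {α}`. -/
def IsConvergenceAction (G M : Type*) [Group G] [TopologicalSpace M] [MulAction G M] : Prop :=
  ∀ g : ℕ → G, Function.Injective g →
    ∃ (α β : M) (φ : ℕ → ℕ), StrictMono φ ∧
      TendstoLocallyUniformlyAway (fun i => g (φ i)) α β ∧
      TendstoLocallyUniformlyAway (fun i => (g (φ i))⁻¹) β α

/-- `x` is a conical limit point: there are a sequence `(g n)` in `G` and distinct points
`α, β ∈ M` with `g n • x → α` while `g n • y → β` for every `y ≠ x`. -/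
def IsConicalLimitPoint (G : Type*) {M : Type*} [Group G] [TopologicalSpace M]
    [MulAction G M] (x : M) : Prop :=
  ∃ (g : ℕ → G) (α β : M), α ≠ β ∧
    Filter.Tendsto (fun n => g n • x) Filter.atTop (nhds α) ∧
    ∀ y : M, y ≠ x → Filter.Tendsto (fun n => g n • y) Filter.atTop (nhds β)

/-- `g` is loxodromic: it has infinite order and fixes exactly two points of `M`. -/
def IsLoxodromic (G : Type*) (M : Type*) [Group G] [TopologicalSpace M] [MulAction G M]
    (g : G) : Prop :=
  ¬ IsOfFinOrder g ∧ ∃ a b : M, a ≠ b ∧ {x : M | g • x = x} = {a, b}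

/-- `p` is a parabolic point: it is the unique point stabilized by some infinite subgroup
of `G` containing no loxodromic elements. -/
def IsParabolicPoint (G : Type*) {M : Type*} [Group G] [TopologicalSpace M]
    [MulAction G M] (p : M) : Prop :=
  ∃ P : Subgroup G, (P : Set G).Infinite ∧ (∀ g ∈ P, ¬ IsLoxodromic G M g) ∧
    {x : M | ∀ g ∈ P, g • x = x} = {p}

/-- `p` is a bounded parabolic point: a parabolic point whose stabilizer acts properly and
cocompactly on `M ∖ {p}`. -/
def IsBoundedParabolicPoint (G : Type*) {M : Type*} [Group G] [TopologicalSpace M]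
    [MulAction G M] (p : M) : Prop :=
  IsParabolicPoint G p ∧
    (∀ K : Set M, K ⊆ {p}ᶜ → IsCompact K →
      {g : G | g • p = p ∧ ((g • K) ∩ K).Nonempty}.Finite) ∧
    ∃ K : Set M, K ⊆ {p}ᶜ ∧ IsCompact K ∧ (⋃ g ∈ {g : G | g • p = p}, g • K) = {p}ᶜ

/-- The action of `G` on `M` is a geometrically finite convergence action: it is a
convergence action and every point of `M` is a conical limit point or a bounded parabolic
point. -/
def IsGeometricallyFinite (G M : Type*) [Group G] [TopologicalSpace M] [MulAction G M] :
    Prop :=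
  IsConvergenceAction G M ∧
    ∀ x : M, IsConicalLimitPoint G x ∨ IsBoundedParabolicPoint G x

/-- Distinct points of a locally connected T₂.₅ space have open connected
neighborhoods with disjoint closures. -/
theorem exists_isOpen_isConnected_disjoint_closure {X : Type*} [TopologicalSpace X]
    [T25Space X] [LocallyConnectedSpace X] {a b : X} (h : a ≠ b) :
    ∃ U V : Set X, (IsOpen U ∧ IsConnected U ∧ a ∈ U) ∧ (IsOpen V ∧ IsConnected V ∧ b ∈ V) ∧
      closure U ∩ closure V = ∅ := by
  obtain ⟨u, hau, hu, v, hbv, hv, huv⟩ := exists_open_nhds_disjoint_closure h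
  refine ⟨connectedComponentIn u a, connectedComponentIn v b,
    ⟨hu.connectedComponentIn, isConnected_connectedComponentIn_iff.2 hau,
      mem_connectedComponentIn hau⟩,
    ⟨hv.connectedComponentIn, isConnected_connectedComponentIn_iff.2 hbv,
      mem_connectedComponentIn hbv⟩, ?_⟩
  exact (huv.mono (closure_mono (connectedComponentIn_subset u a))
    (closure_mono (connectedComponentIn_subset v b))).inter_eq

/-- A compact set of pairs of distinct points is covered by finitely many products of open
connected sets with disjoint closures. -/
theorem IsCompact.exists_finite_cover_separating_pairs {X : Type*} [TopologicalSpace X]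
    [T25Space X] [LocallyConnectedSpace X] {K : Set (X × X)} (hK : IsCompact K)
    (hne : ∀ p ∈ K, p.1 ≠ p.2) :
    ∃ (n : ℕ) (U V : Fin n → Set X),
      (∀ i, IsOpen (U i) ∧ IsConnected (U i)) ∧
      (∀ i, IsOpen (V i) ∧ IsConnected (V i)) ∧
      (∀ i, closure (U i) ∩ closure (V i) = ∅) ∧
      ∀ p ∈ K, ∃ i, p.1 ∈ U i ∧ p.2 ∈ V i := by
  choose! U V hU hV hUV using fun (p : X × X) (hp : p ∈ K) =>
    exists_isOpen_isConnected_disjoint_closure (hne p hp)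
  obtain ⟨t, htK, ht⟩ := hK.elim_nhds_subcover (fun p => U p ×ˢ V p) fun p hp =>
    ((hU p hp).1.prod (hV p hp).1).mem_nhds ⟨(hU p hp).2.2, (hV p hp).2.2⟩
  let q : Fin t.card → X × X := fun i => t.equivFin.symm i
  have hq : ∀ i, q i ∈ K := fun i => htK _ (t.equivFin.symm i).2
  refine ⟨t.card, fun i => U (q i), fun i => V (q i),
    fun i => ⟨(hU _ (hq i)).1, (hU _ (hq i)).2.1⟩,
    fun i => ⟨(hV _ (hq i)).1, (hV _ (hq i)).2.1⟩, fun i => hUV _ (hq i), fun p hp => ?_⟩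
  obtain ⟨r, hr, hpr⟩ := mem_iUnion₂.1 (ht hp)
  refine ⟨t.equivFin ⟨r, hr⟩, ?_⟩
  simpa [q] using hpr

theorem TendstoLocallyUniformlyAway.tendsto {G M : Type*} [TopologicalSpace M] [SMul G M]
    {g : ℕ → G} {α β x : M} (h : TendstoLocallyUniformlyAway g α β) (hx : x ≠ β) :
    Filter.Tendsto (fun n => g n • x) Filter.atTop (nhds α) := by
  refine tendsto_nhds.2 fun U hU hα => ?_
  obtain ⟨N, hN⟩ := h {x} isCompact_singleton (by simpa using hx.symm) U hU hα
  filter_upwards [Filter.eventually_gt_atTop N] with n hn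
  exact hN n hn (smul_mem_smul_set (mem_singleton x))

/-- For a convergence action on an infinite Hausdorff space, a sequence witnessing that `x` is
conical has a subsequence converging locally uniformly on the complement of `x`. -/
theorem IsConvergenceAction.exists_tendstoLocallyUniformlyAway {G M : Type*} [Group G]
    [TopologicalSpace M] [T2Space M] [Infinite M] [MulAction G M]
    (hconv : IsConvergenceAction G M) {g : ℕ → G} {α β x : M} (hαβ : α ≠ β)
    (hx : Filter.Tendsto (fun n => g n • x) Filter.atTop (nhds α))
    (hy : ∀ y, y ≠ x → Filter.Tendsto (fun n => g n • y) Filter.atTop (nhds β)) :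
    ∃ φ : ℕ → ℕ, Filter.Tendsto φ Filter.atTop Filter.atTop ∧
      TendstoLocallyUniformlyAway (fun n => g (φ n)) β x := by
  classical
  have hinf : (range g).Infinite := by
    intro hfin
    have : Finite (range g) := hfin
    obtain ⟨a, ha⟩ := Finite.exists_infinite_fiber (rangeFactorization g)
    have hfreq : ∃ᶠ n in Filter.atTop, g n = a := by
      refine Nat.frequently_atTop_iff_infinite.2 ?_
      convert infinite_coe_iff.1 ha using 1
      ext n
      simp [Subtype.ext_iff]
    have key : ∀ y, y ≠ x → (a : G) • y = β := fun y hyx => by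
      by_contra hne
      obtain ⟨n, hn, hga⟩ := (((hy y hyx).eventually_ne (Ne.symm hne)).and_frequently hfreq).exists
      exact hn (by rw [hga])
    obtain ⟨y, hy₁⟩ := Infinite.exists_notMem_finset ({x} : Finset M)
    obtain ⟨z, hz⟩ := Infinite.exists_notMem_finset ({x, y} : Finset M)
    simp only [Finset.mem_insert, Finset.mem_singleton, not_or] at hy₁ hz
    exact hz.2 (smul_left_cancel (a : G) ((key z hz.1).trans (key y hy₁).symm))
  let e := hinf.natEmbedding
  choose ψ hψ using fun k => (e k).2
  have hinj : Function.Injective fun k => g (ψ k) := fun i j hij =>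
    e.injective (Subtype.ext (by simpa only [hψ] using hij))
  have hψtop : Filter.Tendsto ψ Filter.atTop Filter.atTop :=
    Function.Injective.nat_tendsto_atTop (Function.Injective.of_comp (f := g) hinj)
  obtain ⟨α', β', φ, hφ, hlim, -⟩ := hconv _ hinj
  have htop : Filter.Tendsto (fun n => ψ (φ n)) Filter.atTop Filter.atTop :=
    hψtop.comp hφ.tendsto_atTop
  obtain ⟨y, hyne⟩ := Infinite.exists_notMem_finset ({x, β'} : Finset M)
  simp only [Finset.mem_insert, Finset.mem_singleton, not_or] at hyne
  have hα' : α' = β := tendsto_nhds_unique (hlim.tendsto hyne.2) ((hy y hyne.1).comp htop)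
  have hβ' : x = β' := by
    by_contra hne
    exact hαβ ((tendsto_nhds_unique (hx.comp htop) (hlim.tendsto hne)).trans hα')
  subst hα' hβ'
  exact ⟨fun n => ψ (φ n), htop, hlim⟩

/-- Let `M` be a Peano continuum with at least two points, and let `G` act
on `M` as a convergence group with cocompact induced action on distinct pairs.  Then there
are finite collections `U i`, `V i` of open connected subsets of `M` with disjoint closures
such that for every closed `K ⊆ M` and every conical limit point `x ∉ K`, some translate
puts `x` in some `U i` and `K` in `V i`. -/
theorem exists_separating_open_connected_pairs_for_conical
    {G M : Type*} [Group G] [MetricSpace M] [CompactSpace M] [ConnectedSpace M]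
    [LocallyConnectedSpace M] [MulAction G M]
    (hcont : ContinuousActionOn G M)
    (hconv : IsConvergenceAction G M)
    (hpts : ∃ a b : M, a ≠ b)
    (hcc : CocompactOnDistinctPairs G M) :
    ∃ (p : ℕ) (U V : Fin p → Set M),
      (∀ i, IsOpen (U i) ∧ IsConnected (U i)) ∧
      (∀ i, IsOpen (V i) ∧ IsConnected (V i)) ∧
      (∀ i, closure (U i) ∩ closure (V i) = ∅) ∧
      ∀ K : Set M, IsClosed K → ∀ x : M, x ∉ K → IsConicalLimitPoint G x →
        ∃ (g : G) (i : Fin p), g • x ∈ U i ∧ g • K ⊆ V i := by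
  obtain ⟨a, b, hab⟩ := hpts
  have : Nontrivial M := ⟨a, b, hab⟩
  have : Infinite M := PreconnectedSpace.infinite
  obtain ⟨C, hC, hCne, hCcov⟩ := hcc
  have hne : ∀ p ∈ C ∪ Prod.swap '' C, p.1 ≠ p.2 := by
    rintro p (hp | ⟨q, hq, rfl⟩)
    · exact hCne p hp
    · exact (hCne q hq).symm
  obtain ⟨p, U, V, hU, hV, hUV, hcov⟩ :=
    (hC.union (hC.image continuous_swap)).exists_finite_cover_separating_pairs hne
  refine ⟨p, U, V, hU, hV, hUV, fun K hK x hxK ⟨g, α, β, hαβ, hx, hy⟩ => ?_⟩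
  obtain ⟨φ, hφ, hlim⟩ := hconv.exists_tendstoLocallyUniformlyAway hαβ hx hy
  obtain ⟨h, hh⟩ := hCcov α β hαβ
  obtain ⟨i, hi₁, hi₂⟩ := hcov (h • α, h • β) (hh.imp id fun hmem => ⟨_, hmem, rfl⟩)
  obtain ⟨N, hN⟩ := hlim K hK.isCompact (fun y hyK hyx => hxK (hyx ▸ hyK))
    ((fun y => h • y) ⁻¹' V i) ((hV i).1.preimage (hcont h)) hi₂
  have hU' : ∀ᶠ n in Filter.atTop, h • g (φ n) • x ∈ U i :=
    (((hcont h).tendsto α).comp (hx.comp hφ)).eventually ((hU i).1.mem_nhds hi₁)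
  obtain ⟨n, hnU, hn⟩ := (hU'.and (Filter.eventually_gt_atTop N)).exists
  refine ⟨h * g (φ n), i, by rwa [mul_smul], ?_⟩
  rintro _ ⟨y, hyK, rfl⟩
  have := hN n hn (smul_mem_smul_set hyK)
  simpa [mul_smul] using this
end

section
/- Let G be a group acting as a convergence group on a compact metrizable space M with at least three points. Then a conical limit point of the action cannot be a parabolic point. -/
open Set Pointwise

open Filter Topology

section Convergence

lemma pow_succ_smul_mem {G M : Type*} [Group G] [MulAction G M] {γ : G} {A B : Set M}
    (hAB : Disjoint A B) (hγ : ∀ y ∉ B, γ • y ∈ A) {y : M} (hy : y ∉ B) (n : ℕ) :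
    γ ^ (n + 1) • y ∈ A := by
  induction n with
  | zero => simpa using hγ y hy
  | succ n ih =>
    rw [pow_succ', mul_smul]
    exact hγ _ (Set.disjoint_left.1 hAB ih)

variable {G M : Type*} [Group G] [TopologicalSpace M] [MulAction G M]

/-- Locally uniform convergence away from `β` upgrades to convergence along moving points whose
limit is not `β`. -/
lemma TendstoLocallyUniformlyAway.tendsto_smul [CompactSpace M] [T2Space M] {g : ℕ → G}
    {α β ζ : M} (hg : TendstoLocallyUniformlyAway g α β) (hζ : ζ ≠ β) {z : ℕ → M}
    (hz : Tendsto z atTop (𝓝 ζ)) : Tendsto (fun i => g i • z i) atTop (𝓝 α) := by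
  obtain ⟨C, hC, hCβ, hCc⟩ := local_compact_nhds (isOpen_compl_singleton.mem_nhds hζ)
  rw [tendsto_nhds]
  intro U hU hαU
  obtain ⟨N, hN⟩ := hg C hCc hCβ U hU hαU
  filter_upwards [hz hC, eventually_gt_atTop N] with i hi hNi
  exact hN i hNi (Set.smul_mem_smul_set hi)

lemma TendstoLocallyUniformlyAway.tendsto_smul_const {g : ℕ → G}
    {α β y : M} (hg : TendstoLocallyUniformlyAway g α β) (hy : y ≠ β) :
    Tendsto (fun i => g i • y) atTop (𝓝 α) := by
  rw [tendsto_nhds]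
  intro U hU hαU
  obtain ⟨N, hN⟩ := hg {y} isCompact_singleton (by simpa using hy.symm) U hU hαU
  filter_upwards [eventually_gt_atTop N] with i hi
  exact hN i hi (Set.smul_mem_smul_set rfl)

/-- If powers of `γ` converge to `a` on `M ∖ {b}`, then `γ` fixes `a`, provided some point and its
image avoid `b`. -/
lemma smul_eq_of_tendstoLocallyUniformlyAway_pow [T2Space M] (hcont : ContinuousActionOn G M)
    {γ : G} {φ : ℕ → ℕ} {a b y : M}
    (h : TendstoLocallyUniformlyAway (fun i => γ ^ φ i) a b) (hy : y ≠ b) (hγy : γ • y ≠ b) :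
    γ • a = a := by
  refine tendsto_nhds_unique (((hcont γ).tendsto a).comp (h.tendsto_smul_const hy)) ?_
  refine (h.tendsto_smul_const hγy).congr fun i => ?_
  simp only [Function.comp_apply, smul_smul, (Commute.self_pow γ (φ i)).eq]

lemma mem_closure_of_tendstoLocallyUniformlyAway_pow {γ : G} {A B : Set M} (hAB : Disjoint A B)
    (hγ : ∀ y ∉ B, γ • y ∈ A) {φ : ℕ → ℕ} (hφ : StrictMono φ) {a b y y' : M} (hyy' : y ≠ y')
    (hy : y ∉ B) (hy' : y' ∉ B) (h : TendstoLocallyUniformlyAway (fun i => γ ^ φ i) a b) :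
    a ∈ closure A := by
  obtain ⟨w, hw, hwb⟩ : ∃ w ∉ B, w ≠ b := by
    by_cases hyb : y = b
    · exact ⟨y', hy', fun e => hyy' (hyb.trans e.symm)⟩
    · exact ⟨y, hy, hyb⟩
  refine mem_closure_of_tendsto (h.tendsto_smul_const hwb) ?_
  filter_upwards [eventually_ge_atTop 1] with i hi
  obtain ⟨m, hm⟩ := Nat.exists_eq_add_of_le' (hi.trans (hφ.id_le i))
  simpa only [hm] using pow_succ_smul_mem hAB hγ hw m

/-- An element mapping the complement of `B` into `A` is loxodromic when `A` and `B` have disjoint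
closures and do not cover `M`. -/
lemma isLoxodromic_of_smul_mem [T2Space M]
    (hcont : ContinuousActionOn G M) (hconv : IsConvergenceAction G M) {γ : G} {A B : Set M}
    {α β c : M} (hα : α ∈ A) (hβ : β ∈ B) (hcA : c ∉ A) (hcB : c ∉ B)
    (hAB : Disjoint (closure A) (closure B)) (hγ : ∀ y ∉ B, γ • y ∈ A) : IsLoxodromic G M γ := by
  have hd : Disjoint A B := hAB.mono subset_closure subset_closure
  have hγ' : ∀ y ∉ A, γ⁻¹ • y ∈ B := fun y hy => by
    by_contra hB
    exact hy (by simpa using hγ _ hB)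
  have hord : ¬ IsOfFinOrder γ := by
    rw [isOfFinOrder_iff_pow_eq_one]
    rintro ⟨n, hn, hn1⟩
    obtain ⟨m, rfl⟩ := Nat.exists_eq_add_of_le' hn
    have := pow_succ_smul_mem hd hγ hcB m
    rw [hn1, one_smul] at this
    exact hcA this
  obtain ⟨a, b, φ, hφ, h1, h2⟩ :=
    hconv (fun n => γ ^ n) (injective_pow_iff_not_isOfFinOrder.2 hord)
  simp only [← inv_pow] at h2
  have hαB : α ∉ B := Set.disjoint_left.1 hd hα
  have hβA : β ∉ A := Set.disjoint_right.1 hd hβ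
  have ha : a ∈ closure A := mem_closure_of_tendstoLocallyUniformlyAway_pow hd hγ hφ
    (ne_of_mem_of_not_mem hα hcA) hαB hcB h1
  have hb : b ∈ closure B := mem_closure_of_tendstoLocallyUniformlyAway_pow hd.symm hγ' hφ
    (ne_of_mem_of_not_mem hβ hcB) hβA hcA h2
  have hne : ∀ y ∈ A, y ≠ b := fun y hy e =>
    Set.disjoint_left.1 hAB (subset_closure hy) (e ▸ hb)
  have hne' : ∀ y ∈ B, y ≠ a := fun y hy e =>
    Set.disjoint_left.1 hAB (e ▸ ha) (subset_closure hy)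
  have hfa : γ • a = a :=
    smul_eq_of_tendstoLocallyUniformlyAway_pow hcont h1 (hne _ hα) (hne _ (hγ _ hαB))
  have hfb : γ • b = b := by
    have := smul_eq_of_tendstoLocallyUniformlyAway_pow hcont h2 (hne' _ hβ) (hne' _ (hγ' _ hβA))
    rw [inv_smul_eq_iff] at this
    exact this.symm
  refine ⟨hord, a, b, fun e => Set.disjoint_left.1 hAB ha (e ▸ hb), ?_⟩
  ext w
  simp only [Set.mem_ofPred_eq, Set.mem_insert_iff, Set.mem_singleton_iff]
  refine ⟨fun hw => or_iff_not_imp_right.2 fun hwb => ?_, ?_⟩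
  · refine tendsto_nhds_unique ?_ (h1.tendsto_smul_const hwb)
    have hfix (n : ℕ) : γ ^ n • w = w := by
      induction n with
      | zero => simp
      | succ n ih => rw [pow_succ, mul_smul, hw, ih]
    simp only [hfix]
    exact tendsto_const_nhds
  · rintro (rfl | rfl) <;> assumption

/-- A collapsing sequence with distinct attracting and repelling points contains a loxodromic
element. -/
lemma exists_isLoxodromic_of_tendstoLocallyUniformlyAway [CompactSpace M] [T2Space M]
    (hcont : ContinuousActionOn G M) (hconv : IsConvergenceAction G M) {g : ℕ → G} {α β c : M}
    (hαβ : α ≠ β) (hcα : c ≠ α) (hcβ : c ≠ β) (hg : TendstoLocallyUniformlyAway g α β) :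
    ∃ i, IsLoxodromic G M (g i) := by
  obtain ⟨A, hαA, hA, B, hβB, hB, hAB⟩ := exists_open_nhds_disjoint_closure hαβ
  have hA' : IsOpen (A ∩ {c}ᶜ) := hA.inter isOpen_compl_singleton
  have hB' : IsOpen (B ∩ {c}ᶜ) := hB.inter isOpen_compl_singleton
  have hβB' : β ∈ B ∩ {c}ᶜ := ⟨hβB, hcβ.symm⟩
  have hαA' : α ∈ A ∩ {c}ᶜ := ⟨hαA, hcα.symm⟩
  obtain ⟨N, hN⟩ := hg (B ∩ {c}ᶜ)ᶜ hB'.isClosed_compl.isCompact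
    (Set.compl_subset_compl.2 (Set.singleton_subset_iff.2 hβB')) _ hA' hαA'
  exact ⟨N + 1, isLoxodromic_of_smul_mem hcont hconv hαA' hβB' (fun h => h.2 rfl) (fun h => h.2 rfl)
    (hAB.mono (closure_mono Set.inter_subset_left) (closure_mono Set.inter_subset_left))
    fun y hy => hN _ N.lt_succ_self (Set.smul_mem_smul_set hy)⟩

lemma IsLoxodromic.of_conj {g p : G} (h : IsLoxodromic G M (g * p * g⁻¹)) :
    IsLoxodromic G M p := by
  obtain ⟨hord, a, b, hab, hfix⟩ := h
  refine ⟨fun hp => hord ((MulAut.conj g).toMonoidHom.isOfFinOrder hp), g⁻¹ • a, g⁻¹ • b,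
    fun e => hab (smul_left_cancel _ e), ?_⟩
  ext w
  have := Set.ext_iff.1 hfix (g • w)
  simpa [mul_smul, eq_inv_smul_iff] using this

/-- Conjugating an infinite subgroup by a conical sequence yields infinitely many conjugates that
almost fix a given point, from any index on. -/
lemma exists_seq_conj_injective {P : Subgroup G} (hP : (P : Set G).Infinite) {g : ℕ → G}
    {β y : M} [FirstCountableTopology M]
    (hg : ∀ p ∈ P, Tendsto (fun n => g n • p • y) atTop (𝓝 β)) :
    ∃ (n : ℕ → ℕ) (p : ℕ → G), (∀ k, p k ∈ P) ∧ Tendsto n atTop atTop ∧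
      Tendsto (fun k => g (n k) • p k • y) atTop (𝓝 β) ∧
      Function.Injective fun k => g (n k) * p k * (g (n k))⁻¹ := by
  classical
  obtain ⟨U, hU⟩ := (𝓝 β).exists_antitone_basis
  let c : ℕ × G → G := fun q => g q.1 * q.2 * (g q.1)⁻¹
  have key : ∀ (k : ℕ) (F : Finset G), ∃ q : ℕ × G,
      q.2 ∈ P ∧ k ≤ q.1 ∧ g q.1 • q.2 • y ∈ U k ∧ c q ∉ F := by
    intro k F
    obtain ⟨t, htP, htc⟩ := hP.exists_subset_card_eq (F.card + 1)
    have ev : ∀ᶠ n in atTop, ∀ p ∈ t, g n • p • y ∈ U k :=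
      (eventually_all_finset t).2 fun p hp => hg p (htP hp) (hU.1.mem_of_mem trivial)
    obtain ⟨n, hn, hkn⟩ := (ev.and (eventually_ge_atTop k)).exists
    have hcard : F.card < (t.image fun p => c (n, p)).card := by
      rw [Finset.card_image_of_injective _ fun p q hpq => by simpa [c] using hpq, htc]
      exact Nat.lt_succ_self _
    obtain ⟨_, hct, hcF⟩ := Finset.exists_mem_notMem_of_card_lt_card hcard
    obtain ⟨p, hp, rfl⟩ := Finset.mem_image.1 hct
    exact ⟨(n, p), htP hp, hkn, hn p hp, hcF⟩
  obtain ⟨f, hf, hr⟩ := exists_seq_of_forall_finset_exists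
    (fun q : ℕ × ℕ × G => q.2.2 ∈ P ∧ q.1 ≤ q.2.1 ∧ g q.2.1 • q.2.2 • y ∈ U q.1)
    (fun q r => q.1 < r.1 ∧ c q.2 ≠ c r.2) (by
      intro s _
      obtain ⟨q, h1, h2, h3, h4⟩ := key (s.sup Prod.fst + 1) (s.image fun q => c q.2)
      exact ⟨(_, q), ⟨h1, h2, h3⟩, fun r hr =>
        ⟨Nat.lt_succ_of_le (Finset.le_sup (f := Prod.fst) hr), fun e =>
          h4 (e ▸ Finset.mem_image_of_mem (fun q : ℕ × ℕ × G => c q.2) hr)⟩⟩)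
  have hid : ∀ k, k ≤ (f k).1 :=
    StrictMono.id_le (f := fun k => (f k).1) fun m n hmn => (hr m n hmn).1
  refine ⟨fun k => (f k).2.1, fun k => (f k).2.2, fun k => (hf k).1,
    tendsto_atTop_mono (fun k => (hid k).trans (hf k).2.1) tendsto_id,
    hU.tendsto fun k => hU.2 (hid k) (hf k).2.2, fun m n hmn => ?_⟩
  rcases lt_trichotomy m n with h | h | h
  · exact absurd hmn (hr m n h).2
  · exact h
  · exact absurd hmn.symm (hr n m h).2

end Convergence

/-- If `G` acts as a convergence group on a compact metrizable space `M`
with at least three points, then a conical limit point of the action cannot be a parabolic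
point. -/
theorem conicalLimitPoint_not_parabolicPoint
    {G M : Type*} [Group G] [TopologicalSpace M] [CompactSpace M]
    [TopologicalSpace.MetrizableSpace M] [MulAction G M]
    (hcont : ContinuousActionOn G M)
    (hconv : IsConvergenceAction G M)
    (hpts : ∃ a b c : M, a ≠ b ∧ a ≠ c ∧ b ≠ c)
    (x : M) (hx : IsConicalLimitPoint G x) :
    ¬ IsParabolicPoint G x := by
  rintro ⟨P, hPinf, hPlox, hPfix⟩
  obtain ⟨g, α, β, hαβ, hgx, hgy⟩ := hx
  have hPx : ∀ p ∈ P, p • x = x := by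
    have hmem : x ∈ {x : M | ∀ g ∈ P, g • x = x} := hPfix ▸ Set.mem_singleton x
    exact hmem
  obtain ⟨u, v, w, huv, huw, hvw⟩ := hpts
  have third : ∀ s t : M, ∃ c, c ≠ s ∧ c ≠ t := by
    intro s t
    by_contra! h
    by_cases hu : u = s
    · exact hvw ((h v fun e => huv (hu.trans e.symm)).trans
        (h w fun e => huw (hu.trans e.symm)).symm)
    · by_cases hv : v = s
      · exact huw ((h u hu).trans (h w fun e => hvw (hv.trans e.symm)).symm)
      · exact huv ((h u hu).trans (h v hv).symm)
  obtain ⟨y, hyx, -⟩ := third x x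
  have hPy : ∀ p ∈ P, Tendsto (fun n => g n • p • y) atTop (𝓝 β) := fun p hp =>
    hgy _ fun e => hyx (smul_left_cancel p (e.trans (hPx p hp).symm))
  obtain ⟨n, p, hpP, hn, hpy, hinj⟩ := exists_seq_conj_injective hPinf hPy
  obtain ⟨a, b, φ, hφ, hab, -⟩ := hconv _ hinj
  have hφn : Tendsto (fun i => n (φ i)) atTop atTop := hn.comp hφ.tendsto_atTop
  have hα : α = a ∨ α = b := or_iff_not_imp_right.2 fun hne => by
    refine tendsto_nhds_unique (hgx.comp hφn) ((hab.tendsto_smul hne (hgx.comp hφn)).congr ?_)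
    intro i
    simp [mul_smul, hPx _ (hpP _)]
  have hβ : β = a ∨ β = b := or_iff_not_imp_right.2 fun hne => by
    refine tendsto_nhds_unique (hpy.comp hφ.tendsto_atTop)
      ((hab.tendsto_smul hne ((hgy y hyx).comp hφn)).congr ?_)
    intro i
    simp [mul_smul]
  obtain ⟨c, hca, hcb⟩ := third a b
  have hne : a ≠ b := by grind
  obtain ⟨i, hi⟩ := exists_isLoxodromic_of_tendstoLocallyUniformlyAway hcont hconv hne hca hcb hab
  exact hPlox _ (hpP _) hi.of_conj
end

section
/- Let M be a Peano continuum and let G be a group acting on M as a geometrically finite convergence group. Then the relation ∼, defined on M*(2) by x ∼ y if and only if x = y or 𝒩(x,y) = 2, is an equivalence relation on M*(2). -/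
open Set Pointwise

universe u

/-- `x` is a global cut point: `M ∖ {x}` is disconnected. -/
def IsGlobalCutPoint (M : Type*) [TopologicalSpace M] (x : M) : Prop :=
  ¬ IsPreconnected ({x}ᶜ : Set M)

/-- The valence of `x` equals the cardinal `n`: `M ∖ {x}` has exactly `n` ends (with respect
to any exhaustion). -/
def valenceEq {M : Type u} [TopologicalSpace M] (x : M) (n : Cardinal.{u}) : Prop :=
  ∀ C : ℕ → Set (({x}ᶜ : Set M)), IsExhaustion C → Cardinal.mk (EndsSpace C) = n

/-- The valence of `x` is at least `n`: `M ∖ {x}` has at least `n` ends (with respect to any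
exhaustion). -/
def valenceGe {M : Type u} [TopologicalSpace M] (x : M) (n : Cardinal.{u}) : Prop :=
  ∀ C : ℕ → Set (({x}ᶜ : Set M)), IsExhaustion C → n ≤ Cardinal.mk (EndsSpace C)

/-- `x` is a local cut point: `M ∖ {x}` is disconnected, or it is connected and has more
than one end. -/
def IsLocalCutPoint (M : Type u) [TopologicalSpace M] (x : M) : Prop :=
  ¬ IsPreconnected ({x}ᶜ : Set M) ∨
    (IsPreconnected ({x}ᶜ : Set M) ∧ valenceGe x 2)

/-- `𝒩(a,b)`: the number of connected components of `M ∖ {a, b}`. -/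
def numComplementaryComponents (M : Type u) [TopologicalSpace M] (a b : M) : Cardinal.{u} :=
  Cardinal.mk (ConnectedComponents (({a, b}ᶜ : Set M)))

/-- The pair `{c, d}` separates the points `a` and `b`: both lie in `M ∖ {c, d}`, in
distinct connected components. -/
def PairSeparatesPoints (M : Type*) [TopologicalSpace M] (c d a b : M) : Prop :=
  a ∈ ({c, d}ᶜ : Set M) ∧ b ∈ ({c, d}ᶜ : Set M) ∧
    connectedComponentIn ({c, d}ᶜ : Set M) a ≠ connectedComponentIn ({c, d}ᶜ : Set M) b

/-- The pairs `{a, b}` and `{c, d}` mutually separate: `c, d` lie in distinct components of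
`M ∖ {a, b}` and `a, b` lie in distinct components of `M ∖ {c, d}`. -/
def MutuallySeparate (M : Type*) [TopologicalSpace M] (a b c d : M) : Prop :=
  PairSeparatesPoints M a b c d ∧ PairSeparatesPoints M c d a b

/-- `M*(2)`: the set of conical limit points of valence `2` which are not global cut
points. -/
def Mstar2 (G : Type*) (M : Type u) [Group G] [TopologicalSpace M] [MulAction G M] :
    Set M :=
  {x : M | IsConicalLimitPoint G x ∧ ¬ IsGlobalCutPoint M x ∧ valenceEq x 2}

/-- `M*(3+)`: the set of conical limit points of valence `≥ 3` which are not global cut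
points. -/
def Mstar3plus (G : Type*) (M : Type u) [Group G] [TopologicalSpace M] [MulAction G M] :
    Set M :=
  {x : M | IsConicalLimitPoint G x ∧ ¬ IsGlobalCutPoint M x ∧ valenceGe x 3}

/-- The relation `∼`: `x ∼ y` iff `x = y` or `𝒩(x,y) = 2`. -/
def SimRel {M : Type u} [TopologicalSpace M] (x y : M) : Prop :=
  x = y ∨ numComplementaryComponents M x y = 2

/-- The relation `≈` on `M*(3+)`: `a ≈ b` iff `a ≠ b` and
`𝒩(a,b) = val(a) = val(b) ≥ 3`. -/
def ApproxRel {M : Type u} [TopologicalSpace M] (a b : M) : Prop :=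
  a ≠ b ∧ ∃ n : Cardinal.{u}, 3 ≤ n ∧ numComplementaryComponents M a b = n ∧
    valenceEq a n ∧ valenceEq b n

/-- In a connected, locally connected Hausdorff space, every ultrafilter leaving all compact
sets of an exhaustion determines an end. -/
theorem exists_end_mem_ultrafilter {X : Type*} [TopologicalSpace X] [T2Space X]
    [PreconnectedSpace X] [LocallyConnectedSpace X] {C : ℕ → Set X} (hC : IsExhaustion C)
    (F : Ultrafilter X) (hF : ∀ i, (C i)ᶜ ∈ F) :
    ∃ E : EndsSpace C, ∀ i, E.1 i ∈ F := by
  have key : ∀ i, ∃ x ∈ (C i)ᶜ, connectedComponentIn (C i)ᶜ x ∈ F := by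
    intro i
    by_contra! hcon
    have hopen : IsOpen (C i)ᶜ := (hC.isCompact i).isClosed.isOpen_compl
    have hclosed : IsClosed (C (i + 1)) := (hC.isCompact (i + 1)).isClosed
    have hfr : frontier (C (i + 1)) ⊆ (C i)ᶜ := fun y hy hyi =>
      hy.2 (hC.subset_interior i hyi)
    have hcpt : IsCompact (frontier (C (i + 1))) :=
      (hC.isCompact (i + 1)).of_isClosed_subset isClosed_frontier hclosed.frontier_subset
    obtain ⟨t, ht, hcover⟩ := hcpt.elim_nhds_subcover
      (fun s => connectedComponentIn (C i)ᶜ s) fun s hs =>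
        hopen.connectedComponentIn.mem_nhds (mem_connectedComponentIn (hfr hs))
    have hsub : (C (i + 1))ᶜ ⊆ ⋃ s ∈ (t : Set X), connectedComponentIn (C i)ᶜ s := by
      intro y hy
      have hyi : y ∈ (C i)ᶜ := fun h => hy (interior_subset (hC.subset_interior i h))
      have hyE := mem_connectedComponentIn hyi
      have hpre : IsPreconnected (connectedComponentIn (C i)ᶜ y) :=
        isPreconnected_connectedComponentIn
      by_cases hmeet : (connectedComponentIn (C i)ᶜ y ∩ frontier (C (i + 1))).Nonempty
      · obtain ⟨w, hwE, hwf⟩ := hmeet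
        obtain ⟨s, hs, hws⟩ := mem_iUnion₂.1 (hcover hwf)
        refine mem_iUnion₂.2 ⟨s, hs, ?_⟩
        rwa [connectedComponentIn_eq hws, ← connectedComponentIn_eq hwE]
      · exfalso
        have hE : connectedComponentIn (C i)ᶜ y ⊆ (C (i + 1))ᶜ := by
          intro w hw hwC
          obtain ⟨v, -, hvi, hvc⟩ := hpre (interior (C (i + 1))) (C (i + 1))ᶜ isOpen_interior
            hclosed.isOpen_compl
            (fun v hv => by
              by_cases hvC : v ∈ C (i + 1)
              · exact Or.inl (by_contra fun h => hmeet ⟨v, hv, subset_closure hvC, h⟩)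
              · exact Or.inr hvC)
            ⟨w, hw, by_contra fun h => hmeet ⟨w, hw, subset_closure hwC, h⟩⟩ ⟨y, hyE, hy⟩
          exact hvc (interior_subset hvi)
        have hcl : closure (connectedComponentIn (C i)ᶜ y) ⊆ (C i)ᶜ := by
          refine (closure_mono hE).trans ?_
          rw [closure_compl]
          exact compl_subset_compl.2 (hC.subset_interior i)
        have hclosedE : IsClosed (connectedComponentIn (C i)ᶜ y) :=
          isClosed_of_closure_subset
            (hpre.closure.subset_connectedComponentIn (subset_closure hyE) hcl)
        have huniv := IsClopen.eq_univ ⟨hclosedE, hopen.connectedComponentIn⟩ ⟨y, hyE⟩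
        exact hcon y hyi (huniv ▸ Filter.univ_mem)
    have hmem := F.mem_of_superset (hF (i + 1)) hsub
    obtain ⟨s, hs, hsF⟩ := (Ultrafilter.finite_biUnion_mem_iff t.finite_toSet).1 hmem
    exact hcon s (hfr (ht s hs)) hsF
  choose x hx hxF using key
  refine ⟨⟨fun i => connectedComponentIn (C i)ᶜ (x i), fun i => ⟨x i, hx i, rfl⟩, fun i => ?_⟩,
    hxF⟩
  obtain ⟨w, hw, hw'⟩ := F.nonempty_of_mem (Filter.inter_mem (hxF (i + 1)) (hxF i))
  change connectedComponentIn (C (i + 1))ᶜ (x (i + 1)) ⊆ connectedComponentIn (C i)ᶜ (x i)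
  rw [connectedComponentIn_eq hw', connectedComponentIn_eq hw]
  exact connectedComponentIn_mono w
    (compl_subset_compl.2 ((hC.subset_interior i).trans interior_subset))

/-- The complement of a point in a compact metric space is exhausted by the complements of
balls around the point. -/
theorem isExhaustion_compl_ball {M : Type*} [MetricSpace M] [CompactSpace M] (x : M) :
    IsExhaustion fun i : ℕ => {y : ({x}ᶜ : Set M) | 1 / ((i : ℝ) + 1) ≤ dist y.1 x} where
  isCompact i := by
    rw [Subtype.isCompact_iff]
    have : Subtype.val '' {y : ({x}ᶜ : Set M) | 1 / ((i : ℝ) + 1) ≤ dist y.1 x} =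
        {y : M | 1 / ((i : ℝ) + 1) ≤ dist y x} := by
      ext y
      constructor
      · rintro ⟨w, hw, rfl⟩
        exact hw
      · intro hy
        have hpos : 0 < dist y x := lt_of_lt_of_le (by positivity) hy
        exact ⟨⟨y, dist_pos.1 hpos⟩, hy, rfl⟩
    rw [this]
    exact (isClosed_le continuous_const (continuous_id.dist continuous_const)).isCompact
  subset_interior i := by
    have hopen : IsOpen {y : ({x}ᶜ : Set M) | 1 / (((i + 1 : ℕ) : ℝ) + 1) < dist y.1 x} :=
      isOpen_lt continuous_const (continuous_subtype_val.dist continuous_const)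
    intro y hy
    refine interior_maximal (s := {w : ({x}ᶜ : Set M) | 1 / (((i + 1 : ℕ) : ℝ) + 1) ≤ dist w.1 x})
      (t := {w : ({x}ᶜ : Set M) | 1 / (((i + 1 : ℕ) : ℝ) + 1) < dist w.1 x})
      (fun w (hw : 1 / (((i + 1 : ℕ) : ℝ) + 1) < dist w.1 x) => hw.le) hopen ?_
    have hlt : 1 / (((i + 1 : ℕ) : ℝ) + 1) < 1 / ((i : ℝ) + 1) := by
      apply one_div_lt_one_div_of_lt (by positivity)
      push_cast
      linarith
    exact lt_of_lt_of_le hlt hy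
  iUnion_eq := by
    refine eq_univ_of_forall fun y => mem_iUnion.2 ?_
    obtain ⟨n, hn⟩ := exists_nat_one_div_lt (dist_pos.2 y.2)
    exact ⟨n, hn.le⟩

/-- If finitely many disjoint open sets fill a punctured neighbourhood of a point that is not a
global cut point, and all of them accumulate at the point, then their number is at most the
valence. -/
theorem card_le_of_valenceEq {M : Type u} [MetricSpace M] [CompactSpace M]
    [LocallyConnectedSpace M] {x : M} (hx : ¬ IsGlobalCutPoint M x) {n k : ℕ}
    (hval : valenceEq x n) (O : Fin k → Set M) (hO : ∀ i, IsOpen (O i))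
    (hdisj : Pairwise fun i j => Disjoint (O i) (O j)) (hxO : ∀ i, x ∉ O i)
    (hcl : ∀ i, x ∈ closure (O i)) (hnhds : insert x (⋃ i, O i) ∈ nhds x) : k ≤ n := by
  have hpre : IsPreconnected ({x}ᶜ : Set M) := not_not.1 hx
  have : PreconnectedSpace ({x}ᶜ : Set M) := isPreconnected_iff_preconnectedSpace.1 hpre
  have : LocallyConnectedSpace ({x}ᶜ : Set M) :=
    isOpen_compl_singleton.locallyConnectedSpace
  have hC := isExhaustion_compl_ball x
  set C := fun i : ℕ => {y : ({x}ᶜ : Set M) | 1 / ((i : ℝ) + 1) ≤ dist y.1 x} with hCdef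
  have hends : ∀ i, ∃ E : EndsSpace C, ∀ m, (Subtype.val '' E.1 m ∩ O i).Nonempty := by
    intro i
    have : (Filter.comap (Subtype.val : ({x}ᶜ : Set M) → M) (nhdsWithin x (O i))).NeBot := by
      have := mem_closure_iff_nhdsWithin_neBot.1 (hcl i)
      refine Filter.comap_neBot_iff.2 fun t ht => ?_
      obtain ⟨w, hwt, hwO⟩ := Filter.nonempty_of_mem (Filter.inter_mem ht self_mem_nhdsWithin)
      exact ⟨⟨w, fun h => hxO i (h ▸ hwO)⟩, hwt⟩
    have hle := Ultrafilter.of_le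
      (Filter.comap (Subtype.val : ({x}ᶜ : Set M) → M) (nhdsWithin x (O i)))
    obtain ⟨E, hE⟩ := exists_end_mem_ultrafilter hC (Ultrafilter.of
      (Filter.comap (Subtype.val : ({x}ᶜ : Set M) → M) (nhdsWithin x (O i)))) fun m => by
        refine hle ⟨Metric.ball x (1 / ((m : ℝ) + 1)),
          mem_nhdsWithin_of_mem_nhds (Metric.ball_mem_nhds _ (by positivity)), fun y hy => ?_⟩
        simpa [hCdef] using hy
    refine ⟨E, fun m => ?_⟩
    obtain ⟨w, hwE, hwO⟩ := Ultrafilter.nonempty_of_mem (Filter.inter_mem (hE m)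
      (hle (Filter.preimage_mem_comap self_mem_nhdsWithin)))
    exact ⟨w, ⟨w, hwE, rfl⟩, hwO⟩
  choose E hE using hends
  obtain ⟨ε, hε, hball⟩ := Metric.mem_nhds_iff.1 hnhds
  obtain ⟨N, hN⟩ := exists_nat_one_div_lt hε
  have hinj : Function.Injective E := by
    intro i j hij
    by_contra hne
    obtain ⟨p, hp, hEp⟩ := (E i).2.1 N
    have hpreE : IsPreconnected (Subtype.val '' (E i).1 N) := by
      rw [hEp]
      exact isPreconnected_connectedComponentIn.image _ continuous_subtype_val.continuousOn
    have hsub : Subtype.val '' (E i).1 N ⊆ O i ∪ ⋃ l ∈ {l | l ≠ i}, O l := by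
      rintro _ ⟨w, hw, rfl⟩
      rw [hEp] at hw
      have hwC : w ∈ (C N)ᶜ := connectedComponentIn_subset _ _ hw
      have hwd : dist w.1 x < 1 / ((N : ℝ) + 1) := not_le.1 hwC
      rcases hball (Metric.mem_ball.2 (hwd.trans hN)) with h | h
      · exact absurd h w.2
      · obtain ⟨l, hl⟩ := mem_iUnion.1 h
        by_cases hli : l = i
        · exact Or.inl (hli ▸ hl)
        · exact Or.inr (mem_iUnion₂.2 ⟨l, hli, hl⟩)
    have hmeet : (Subtype.val '' (E i).1 N ∩ ⋃ l ∈ {l | l ≠ i}, O l).Nonempty := by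
      obtain ⟨w, hwE, hwO⟩ := hE j N
      exact ⟨w, hij ▸ hwE, mem_iUnion₂.2 ⟨j, Ne.symm hne, hwO⟩⟩
    obtain ⟨w, -, hwi, hwl⟩ := hpreE _ _ (hO i) (isOpen_biUnion fun l _ => hO l) hsub (hE i N)
      hmeet
    obtain ⟨l, hl, hwl⟩ := mem_iUnion₂.1 hwl
    exact (hdisj hl).ne_of_mem hwl hwi rfl
  have hcard := Cardinal.mk_le_of_injective
    (Function.Injective.comp hinj (Equiv.ulift.{u} (α := Fin k)).injective)
  rw [hval C hC] at hcard
  simpa using hcard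

/-- A point of valence `2` that is not a global cut point is not accumulated by all of three
disjoint open sets filling a punctured neighbourhood of it. -/
theorem not_three_open_of_valenceEq_two {M : Type u} [MetricSpace M] [CompactSpace M]
    [LocallyConnectedSpace M] {x : M} (hx : ¬ IsGlobalCutPoint M x) (hval : valenceEq x 2)
    {P Q R : Set M} (hP : IsOpen P) (hQ : IsOpen Q) (hR : IsOpen R) (hPQ : Disjoint P Q)
    (hPR : Disjoint P R) (hQR : Disjoint Q R) (hxP : x ∈ closure P) (hxQ : x ∈ closure Q)
    (hxR : x ∈ closure R) (hx' : x ∉ P ∪ Q ∪ R) (hnhds : insert x (P ∪ Q ∪ R) ∈ nhds x) :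
    False := by
  have h := card_le_of_valenceEq (n := 2) (k := 3) hx (by exact_mod_cast hval) ![P, Q, R]
    (by simp [Fin.forall_fin_succ, hP, hQ, hR])
    (by
      intro i j hij
      fin_cases i <;> fin_cases j <;>
        first
          | exact absurd rfl hij
          | simp [hPQ, hPR, hQR, hPQ.symm, hPR.symm, hQR.symm])
    (by
      simp only [mem_union, not_or] at hx'
      simp [Fin.forall_fin_succ, hx'])
    (by simp [Fin.forall_fin_succ, hxP, hxQ, hxR])
    (Filter.mem_of_superset hnhds (insert_subset_insert (by
      rintro w ((h | h) | h)
      · exact mem_iUnion.2 ⟨0, h⟩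
      · exact mem_iUnion.2 ⟨1, h⟩
      · exact mem_iUnion.2 ⟨2, h⟩)))
  omega

/-- If `z` is not a global cut point, a nonempty open set with frontier in `{x, z}` that avoids
`x` and `z` accumulates at `x`. -/
theorem mem_closure_of_not_isGlobalCutPoint {M : Type*} [TopologicalSpace M] {x z : M}
    (hz : ¬ IsGlobalCutPoint M z) (hxz : x ≠ z) {O : Set M} (hO : IsOpen O)
    (hne : O.Nonempty) (hzO : z ∉ O) (hcl : closure O ⊆ O ∪ {x, z}) :
    x ∈ closure O := by
  by_contra hx
  obtain ⟨w, hw⟩ := hne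
  obtain ⟨v, -, hv, hv'⟩ := not_not.1 hz O (closure O)ᶜ hO isClosed_closure.isOpen_compl
    (by
      intro v hv
      by_cases h : v ∈ closure O
      · rcases hcl h with h' | rfl | h'
        · exact Or.inl h'
        · exact absurd h hx
        · exact absurd h' hv
      · exact Or.inr h)
    ⟨w, fun h => hzO (h ▸ hw), hw⟩ ⟨x, hxz, hx⟩
  exact hv' (subset_closure hv)

/-- `U` and `V` are nonempty disjoint open sets partitioning `S`. -/
structure IsOpenSplitting {M : Type*} [TopologicalSpace M] (S U V : Set M) : Prop where
  isOpen_left : IsOpen U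
  isOpen_right : IsOpen V
  nonempty_left : U.Nonempty
  nonempty_right : V.Nonempty
  disjoint : Disjoint U V
  union_eq : U ∪ V = S

theorem IsOpenSplitting.symm {M : Type*} [TopologicalSpace M] {S U V : Set M}
    (h : IsOpenSplitting S U V) : IsOpenSplitting S V U :=
  ⟨h.isOpen_right, h.isOpen_left, h.nonempty_right, h.nonempty_left, h.disjoint.symm,
    by rw [union_comm, h.union_eq]⟩

theorem IsOpenSplitting.closure_left_subset {M : Type*} [TopologicalSpace M] {T U V : Set M}
    (h : IsOpenSplitting Tᶜ U V) : closure U ⊆ U ∪ T := by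
  intro w hw
  by_cases hwT : w ∈ T
  · exact Or.inr hwT
  · have hUV : w ∈ U ∪ V := h.union_eq ▸ hwT
    exact hUV.imp_right fun hV =>
      absurd hV ((h.disjoint.closure_left h.isOpen_right).notMem_of_mem_left hw)

theorem IsOpenSplitting.notMem_left {M : Type*} [TopologicalSpace M] {T U V : Set M}
    (h : IsOpenSplitting Tᶜ U V) {t : M} (ht : t ∈ T) : t ∉ U := fun hU => by
  have htT : t ∈ Tᶜ := h.union_eq.subset (Or.inl hU)
  exact htT ht

theorem IsOpenSplitting.mem_closure_left {M : Type*} [TopologicalSpace M] {x z : M}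
    {U V : Set M} (h : IsOpenSplitting {x, z}ᶜ U V) (hz : ¬ IsGlobalCutPoint M z)
    (hxz : x ≠ z) : x ∈ closure U :=
  mem_closure_of_not_isGlobalCutPoint hz hxz h.isOpen_left h.nonempty_left
    (h.notMem_left (by simp)) h.closure_left_subset

/-- A nonempty proper set of components of an open set splits it. -/
theorem isOpenSplitting_of_connectedComponents {M : Type*} [TopologicalSpace M]
    [LocallyConnectedSpace M] {S : Set M} (hS : IsOpen S) {s : Set (ConnectedComponents S)}
    (hs : s.Nonempty) (hs' : sᶜ.Nonempty) :
    IsOpenSplitting S (Subtype.val '' (ConnectedComponents.mk ⁻¹' s : Set S))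
      (Subtype.val '' (ConnectedComponents.mk ⁻¹' sᶜ : Set S)) := by
  have := hS.locallyConnectedSpace
  refine ⟨hS.isOpenMap_subtype_val _ ?_, hS.isOpenMap_subtype_val _ ?_, ?_, ?_, ?_, ?_⟩
  · exact (isOpen_discrete _).preimage ConnectedComponents.continuous_coe
  · exact (isOpen_discrete _).preimage ConnectedComponents.continuous_coe
  · exact (hs.preimage ConnectedComponents.surjective_coe).image _
  · exact (hs'.preimage ConnectedComponents.surjective_coe).image _
  · rw [disjoint_image_iff Subtype.val_injective]
    exact disjoint_compl_right.preimage _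
  · rw [← image_union, ← preimage_union, union_compl_self, preimage_univ, image_univ,
      Subtype.range_coe]

theorem exists_isOpenSplitting {M : Type u} [TopologicalSpace M] [T1Space M]
    [LocallyConnectedSpace M] {a b : M} (h : numComplementaryComponents M a b = 2) :
    ∃ U V, IsOpenSplitting ({a, b}ᶜ : Set M) U V := by
  obtain ⟨p, q, hpq, -⟩ := Cardinal.mk_eq_two_iff.1 h
  exact ⟨_, _, isOpenSplitting_of_connectedComponents (Set.toFinite _).isClosed.isOpen_compl
    (singleton_nonempty p) ⟨q, hpq.symm⟩⟩

/-- If `a` has valence `2`, `a` and `b` are not global cut points and `M ∖ {a, b}` is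
disconnected, then `M ∖ {a, b}` has exactly two components. -/
theorem numComplementaryComponents_eq_two {M : Type u} [MetricSpace M] [CompactSpace M]
    [LocallyConnectedSpace M] {a b : M} (hab : a ≠ b) (ha : ¬ IsGlobalCutPoint M a)
    (hb : ¬ IsGlobalCutPoint M b) (hval : valenceEq a 2) {U V : Set M}
    (h : IsOpenSplitting ({a, b}ᶜ : Set M) U V) :
    numComplementaryComponents M a b = 2 := by
  have hS : IsOpen ({a, b}ᶜ : Set M) := (Set.toFinite _).isClosed.isOpen_compl
  have := hS.locallyConnectedSpace
  obtain ⟨u, hu⟩ := h.nonempty_left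
  obtain ⟨v, hv⟩ := h.nonempty_right
  have huS : u ∈ ({a, b}ᶜ : Set M) := h.union_eq.subset (Or.inl hu)
  have hvS : v ∈ ({a, b}ᶜ : Set M) := h.union_eq.subset (Or.inr hv)
  set p : ConnectedComponents ({a, b}ᶜ : Set M) := ConnectedComponents.mk ⟨u, huS⟩
  set q : ConnectedComponents ({a, b}ᶜ : Set M) := ConnectedComponents.mk ⟨v, hvS⟩
  have hpq : p ≠ q := by
    intro heq
    have hclopen : IsClopen (Subtype.val ⁻¹' U : Set ({a, b}ᶜ : Set M)) := by
      refine ⟨⟨?_⟩, h.isOpen_left.preimage continuous_subtype_val⟩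
      convert h.isOpen_right.preimage continuous_subtype_val using 1
      ext w
      have hw : w.1 ∈ U ∪ V := h.union_eq.superset w.2
      exact ⟨fun hwU => hw.resolve_left hwU, fun hwV hwU => h.disjoint.ne_of_mem hwU hwV rfl⟩
    have hvc : (⟨v, hvS⟩ : ({a, b}ᶜ : Set M)) ∈ connectedComponent ⟨u, huS⟩ :=
      ConnectedComponents.coe_eq_coe'.1 heq.symm
    exact h.disjoint.ne_of_mem (hclopen.connectedComponent_subset hu hvc) hv rfl
  refine Cardinal.mk_eq_two_iff.2 ⟨p, q, hpq, ?_⟩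
  by_contra hcon
  obtain ⟨r, hr⟩ := (ne_univ_iff_exists_notMem _).1 hcon
  simp only [mem_insert_iff, mem_singleton_iff, not_or] at hr
  have hP := isOpenSplitting_of_connectedComponents hS (singleton_nonempty p) ⟨q, hpq.symm⟩
  have hQ := isOpenSplitting_of_connectedComponents hS (singleton_nonempty q) ⟨p, hpq⟩
  have hR := isOpenSplitting_of_connectedComponents hS (s := {p, q}ᶜ)
    ⟨r, by simp [hr.1, hr.2]⟩ ⟨p, by simp⟩
  have hunion : Subtype.val '' (ConnectedComponents.mk ⁻¹' {p} : Set ({a, b}ᶜ : Set M)) ∪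
      Subtype.val '' (ConnectedComponents.mk ⁻¹' {q} : Set ({a, b}ᶜ : Set M)) ∪
      Subtype.val '' (ConnectedComponents.mk ⁻¹' {p, q}ᶜ : Set ({a, b}ᶜ : Set M)) =
        {a, b}ᶜ := by
    rw [← image_union, ← image_union, ← preimage_union, ← preimage_union, singleton_union,
      union_compl_self, preimage_univ, image_univ, Subtype.range_coe]
  refine not_three_open_of_valenceEq_two ha hval hP.isOpen_left hQ.isOpen_left hR.isOpen_left
    ?_ ?_ ?_ (hP.mem_closure_left hb hab) (hQ.mem_closure_left hb hab)
    (hR.mem_closure_left hb hab) ?_ ?_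
  · rw [disjoint_image_iff Subtype.val_injective]
    exact (disjoint_singleton.2 hpq).preimage _
  · rw [disjoint_image_iff Subtype.val_injective]
    exact (disjoint_compl_right.mono_left (by simp)).preimage _
  · rw [disjoint_image_iff Subtype.val_injective]
    exact (disjoint_compl_right.mono_left (by simp)).preimage _
  · rw [hunion]
    simp
  · rw [hunion]
    refine Filter.mem_of_superset (isOpen_compl_singleton.mem_nhds hab) fun w hw => ?_
    by_cases hwa : w = a
    · exact Or.inl hwa
    · exact Or.inr (by simpa [hwa] using hw)

/-- If `y` has valence `2`, splittings of `M ∖ {x, y}` and `M ∖ {y, z}` with `z` and `x` on the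
distinguished sides yield a splitting of `M ∖ {x, z}`. -/
theorem IsOpenSplitting.exists_trans {M : Type u} [MetricSpace M] [CompactSpace M]
    [LocallyConnectedSpace M] {x y z : M} (hxy : x ≠ y) (hyz : y ≠ z)
    (hx : ¬ IsGlobalCutPoint M x) (hy : ¬ IsGlobalCutPoint M y) (hz : ¬ IsGlobalCutPoint M z)
    (hvaly : valenceEq y 2) {U V A B : Set M}
    (hUV : IsOpenSplitting ({x, y}ᶜ : Set M) U V) (hAB : IsOpenSplitting ({y, z}ᶜ : Set M) A B)
    (hzU : z ∈ U) (hxA : x ∈ A) :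
    ∃ P Q, IsOpenSplitting ({x, z}ᶜ : Set M) P Q := by
  have hVcl := hUV.symm.closure_left_subset
  have hBcl := hAB.symm.closure_left_subset
  have hzV : z ∉ V := hUV.disjoint.notMem_of_mem_left hzU
  have hxB : x ∉ B := hAB.disjoint.notMem_of_mem_left hxA
  have hyU : y ∉ U := hUV.notMem_left (by simp)
  have hyV : y ∉ V := hUV.symm.notMem_left (by simp)
  have hyB : y ∉ B := hAB.symm.notMem_left (by simp)
  have hxU : x ∉ U := hUV.notMem_left (by simp)
  have hzA : z ∉ A := hAB.notMem_left (by simp)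
  have hxV : x ∉ V := hUV.symm.notMem_left (by simp)
  have hVB : V ∩ B = ∅ := by
    by_contra hne
    have hcl : closure (V ∩ B) ⊆ V ∩ B ∪ {y} := by
      intro w hw
      have h1 := hVcl (closure_mono inter_subset_left hw)
      have h2 := hBcl (closure_mono inter_subset_right hw)
      simp only [mem_union, mem_inter_iff, mem_insert_iff, mem_singleton_iff] at h1 h2 ⊢
      grind
    have hmem := hcl (mem_closure_of_not_isGlobalCutPoint (x := x) hy hxy
      (hUV.isOpen_right.inter hAB.isOpen_right) (nonempty_iff_ne_empty.2 hne)
      (fun h => hyV h.1) (hcl.trans (union_subset_union_right _ (by simp))))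
    simp [hxV, hxy] at hmem
  have hyUA : y ∉ closure (U ∩ A) := by
    intro hmem
    refine not_three_open_of_valenceEq_two hy hvaly hUV.isOpen_right hAB.isOpen_right
      (hUV.isOpen_left.inter hAB.isOpen_left) (disjoint_iff_inter_eq_empty.2 hVB)
      (hUV.disjoint.symm.mono_right inter_subset_left)
      (hAB.disjoint.symm.mono_right inter_subset_right)
      (IsOpenSplitting.mem_closure_left (pair_comm x y ▸ hUV.symm) hx hxy.symm)
      (hAB.symm.mem_closure_left hz hyz) hmem (by simp [hyV, hyB, hyU]) ?_
    refine Filter.mem_of_superset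
      ((Set.toFinite {x, z}).isClosed.isOpen_compl.mem_nhds (by simp [hxy.symm, hyz])) ?_
    intro w hw
    have h1 : w ∉ ({x, y} : Set M) → w ∈ U ∪ V := fun h => hUV.union_eq ▸ h
    have h2 : w ∉ ({y, z} : Set M) → w ∈ A ∪ B := fun h => hAB.union_eq ▸ h
    simp only [mem_union, mem_inter_iff, mem_insert_iff, mem_singleton_iff,
      mem_compl_iff] at h1 h2 hw ⊢
    grind
  have hcl : closure (U ∩ A) ⊆ U ∩ A ∪ {x, z} := by
    intro w hw
    have h1 := hUV.closure_left_subset (closure_mono inter_subset_left hw)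
    have h2 := hAB.closure_left_subset (closure_mono inter_subset_right hw)
    have h3 : w ≠ y := fun h => hyUA (h ▸ hw)
    simp only [mem_union, mem_inter_iff, mem_insert_iff, mem_singleton_iff] at h1 h2 ⊢
    grind
  have hzcl : z ∈ closure A :=
    IsOpenSplitting.mem_closure_left (pair_comm y z ▸ hAB) hy hyz.symm
  refine ⟨U ∩ A, (closure (U ∩ A))ᶜ ∩ {x, z}ᶜ, hUV.isOpen_left.inter hAB.isOpen_left,
    isClosed_closure.isOpen_compl.inter (Set.toFinite _).isClosed.isOpen_compl,
    mem_closure_iff.1 hzcl U hUV.isOpen_left hzU, ⟨y, hyUA, by simp [hxy.symm, hyz]⟩,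
    (disjoint_compl_right.mono_left subset_closure).mono_right inter_subset_left, ?_⟩
  ext w
  constructor
  · rintro (⟨hwU, hwA⟩ | hw)
    · rintro (rfl | rfl)
      · exact hxU hwU
      · exact hzA hwA
    · exact hw.2
  · intro hw
    by_cases hwcl : w ∈ closure (U ∩ A)
    · exact Or.inl ((hcl hwcl).resolve_right hw)
    · exact Or.inr ⟨hwcl, hw⟩

/-- Let `M` be a Peano continuum and `G` a group acting on `M` as a
geometrically finite convergence group.  Then the relation `∼` (`x ∼ y` iff `x = y` or
`𝒩(x,y) = 2`) is an equivalence relation on `M*(2)`. -/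
theorem simRel_equivalence_on_Mstar2
    {G : Type*} {M : Type u} [Group G] [MetricSpace M] [CompactSpace M] [ConnectedSpace M]
    [LocallyConnectedSpace M] [MulAction G M]
    (hcont : ContinuousActionOn G M)
    (hgf : IsGeometricallyFinite G M) :
    Equivalence (fun x y : ↥(Mstar2 G M) => SimRel x.1 y.1) := by
  refine ⟨fun x => Or.inl rfl, ?_, ?_⟩
  · rintro x y (h | h)
    · exact Or.inl h.symm
    · refine Or.inr ?_
      rwa [numComplementaryComponents, pair_comm]
  · rintro ⟨x, _, hx, hvalx⟩ ⟨y, _, hy, hvaly⟩ ⟨z, _, hz, _⟩ hxy hyz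
    simp only [SimRel] at hxy hyz ⊢
    rcases eq_or_ne x y with rfl | hxy'
    · exact hyz
    rcases eq_or_ne y z with rfl | hyz'
    · exact hxy
    rcases eq_or_ne x z with hxz | hxz
    · exact Or.inl hxz
    refine Or.inr ?_
    obtain ⟨U, V, hUV, hzU⟩ : ∃ U V, IsOpenSplitting ({x, y}ᶜ : Set M) U V ∧ z ∈ U := by
      obtain ⟨U, V, hUV⟩ := exists_isOpenSplitting (hxy.resolve_left hxy')
      rcases hUV.union_eq.superset (show z ∈ ({x, y}ᶜ : Set M) by
        simp [hxz.symm, hyz'.symm]) with h | h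
      · exact ⟨U, V, hUV, h⟩
      · exact ⟨V, U, hUV.symm, h⟩
    obtain ⟨A, B, hAB, hxA⟩ : ∃ A B, IsOpenSplitting ({y, z}ᶜ : Set M) A B ∧ x ∈ A := by
      obtain ⟨A, B, hAB⟩ := exists_isOpenSplitting (hyz.resolve_left hyz')
      rcases hAB.union_eq.superset (show x ∈ ({y, z}ᶜ : Set M) by simp [hxz, hxy']) with h | h
      · exact ⟨A, B, hAB, h⟩
      · exact ⟨B, A, hAB.symm, h⟩
    obtain ⟨P, Q, hPQ⟩ := hUV.exists_trans hxy' hyz' hx hy hz hvaly hAB hzU hxA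
    exact numComplementaryComponents_eq_two hxz hx hz hvalx hPQ
end

section
/- Let M be a Peano continuum and let G be a group acting on M as a geometrically finite convergence group, and let a, b, c, d ∈ M*(2). If a ∼ b and the pair {c,d} separates {a,b} (that is, a and b lie in distinct components of M ∖ {c,d}), then c ∼ d ∼ a ∼ b, and the pairs {a,b} and {c,d} mutually separate. -/
open Set Pointwise

universe u

section ComponentLemmas

variable {X : Type*} [TopologicalSpace X]

theorem closure_connectedComponentIn_inter_subset {F : Set X} {x : X} (hx : x ∈ F) :
    closure (connectedComponentIn F x) ∩ F ⊆ connectedComponentIn F x := by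
  have hpre : IsPreconnected (closure (connectedComponentIn F x) ∩ F) :=
    isPreconnected_connectedComponentIn.subset_closure
      (subset_inter subset_closure (connectedComponentIn_subset F x)) inter_subset_left
  exact hpre.subset_connectedComponentIn
    ⟨subset_closure (mem_connectedComponentIn hx), hx⟩ inter_subset_right

theorem mk_eq_mk_iff_connectedComponentIn_eq {F : Set X} {x y : X} (hx : x ∈ F) (hy : y ∈ F) :
    (ConnectedComponents.mk (⟨x, hx⟩ : F) = ConnectedComponents.mk ⟨y, hy⟩) ↔
      connectedComponentIn F x = connectedComponentIn F y := by
  rw [ConnectedComponents.coe_eq_coe, connectedComponentIn_eq_image hx,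
    connectedComponentIn_eq_image hy, Subtype.val_injective.image_injective.eq_iff]

/-- If an ultrafilter eventually leaves a compact neighbourhood `K` of the compact set `L`, it
contains a component of the complement of `L`. -/
theorem exists_connectedComponentIn_compl_mem [PreconnectedSpace X] [T2Space X]
    [LocallyConnectedSpace X] {L K : Set X} (hL : IsCompact L) (hK : IsCompact K)
    (hLK : L ⊆ interior K) (hKne : K.Nonempty) (F : Ultrafilter X) (hF : Kᶜ ∈ F) :
    ∃ s ∈ Lᶜ, connectedComponentIn Lᶜ s ∈ F := by
  have hmeet : ∀ x ∈ Kᶜ, ∃ s ∈ frontier K, s ∈ connectedComponentIn Lᶜ x := by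
    intro x hx
    have hxL : x ∈ Lᶜ := fun h => hx (interior_subset (hLK h))
    by_contra! hmiss
    have hsub : connectedComponentIn Lᶜ x ⊆ Kᶜ := by
      refine isPreconnected_connectedComponentIn.subset_of_closure_inter_subset
        hK.isClosed.isOpen_compl ⟨x, mem_connectedComponentIn hxL, hx⟩ ?_
      rintro y ⟨hy, hyQ⟩ hyK
      refine hmiss y ?_ hyQ
      rw [frontier_eq_closure_inter_closure]
      exact ⟨subset_closure hyK, hy⟩
    have hclosed : IsClosed (connectedComponentIn Lᶜ x) := by
      refine closure_subset_iff_isClosed.mp fun y hy => ?_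
      refine closure_connectedComponentIn_inter_subset hxL ⟨hy, fun hyL => ?_⟩
      have := closure_mono hsub hy
      rw [closure_compl] at this
      exact this (hLK hyL)
    have huniv := IsClopen.eq_univ ⟨hclosed, hL.isClosed.isOpen_compl.connectedComponentIn⟩
      ⟨x, mem_connectedComponentIn hxL⟩
    obtain ⟨k, hk⟩ := hKne
    exact hsub (huniv ▸ mem_univ k) hk
  choose! f hf hfc using hmeet
  have hcpt : IsCompact (frontier K) := hK.of_isClosed_subset isClosed_frontier
    hK.isClosed.frontier_subset
  obtain ⟨s, hs, hlim⟩ := hcpt.ultrafilter_le_nhds (F.map f)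
    (Filter.le_principal_iff.mpr (Ultrafilter.mem_map.mpr (Filter.mem_of_superset hF hf)))
  have hsL : s ∈ Lᶜ := fun h => hs.2 (hLK h)
  have hmem : f ⁻¹' connectedComponentIn Lᶜ s ∈ F :=
    hlim (hL.isClosed.isOpen_compl.connectedComponentIn.mem_nhds (mem_connectedComponentIn hsL))
  refine ⟨s, hsL, Filter.mem_of_superset (Filter.inter_mem hF hmem) ?_⟩
  rintro x ⟨hx, hxs⟩
  rw [connectedComponentIn_eq hxs, ← connectedComponentIn_eq (hfc x hx)]
  exact mem_connectedComponentIn fun h => hx (interior_subset (hLK h))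

/-- An ultrafilter leaving every compact set of an exhaustion converges to an end. -/
theorem exists_end_forall_mem [PreconnectedSpace X] [T2Space X]
    [LocallyConnectedSpace X] {C : ℕ → Set X} (hC : IsExhaustion C) (hne : (C 0).Nonempty)
    (F : Ultrafilter X) (hF : ∀ i, (C i)ᶜ ∈ F) :
    ∃ E : EndsSpace C, ∀ i, E.1 i ∈ F := by
  have hsub : ∀ i, C i ⊆ C (i + 1) := fun i => (hC.subset_interior i).trans interior_subset
  have hne' : ∀ i, (C i).Nonempty := fun i => by
    induction i with
    | zero => exact hne
    | succ i ih => exact ih.mono (hsub i)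
  choose s hs hsF using fun i => exists_connectedComponentIn_compl_mem (hC.isCompact i)
    (hC.isCompact (i + 1)) (hC.subset_interior i) (hne' (i + 1)) F (hF (i + 1))
  refine ⟨⟨fun i => connectedComponentIn (C i)ᶜ (s i), fun i => ⟨s i, hs i, rfl⟩, fun i => ?_⟩, hsF⟩
  obtain ⟨y, hy, hy'⟩ := F.nonempty_of_mem (Filter.inter_mem (hsF i) (hsF (i + 1)))
  beta_reduce
  rw [connectedComponentIn_eq hy]
  exact isPreconnected_connectedComponentIn.subset_connectedComponentIn hy'
    ((connectedComponentIn_subset _ _).trans (compl_subset_compl.mpr (hsub i)))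

theorem exists_isExhaustion_mem_zero [WeaklyLocallyCompactSpace X] [SigmaCompactSpace X]
    (x : X) : ∃ C : ℕ → Set X, IsExhaustion C ∧ x ∈ C 0 := by
  let K : CompactExhaustion X := default
  obtain ⟨n, hn⟩ := K.exists_mem x
  refine ⟨fun i => K (n + i), ⟨fun i => K.isCompact _, fun i => K.subset_interior_succ _, ?_⟩, hn⟩
  refine eq_univ_of_forall fun y => ?_
  obtain ⟨m, hm⟩ := K.exists_mem y
  exact mem_iUnion.mpr ⟨m, K.subset (Nat.le_add_left m n) hm⟩

end ComponentLemmas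

section Pairs

theorem PairSeparatesPoints.symm {M : Type*} [TopologicalSpace M] {a b c d : M}
    (h : PairSeparatesPoints M a b c d) : PairSeparatesPoints M a b d c :=
  ⟨h.2.1, h.1, h.2.2.symm⟩

theorem PairSeparatesPoints.comm {M : Type*} [TopologicalSpace M] {a b c d : M}
    (h : PairSeparatesPoints M a b c d) : PairSeparatesPoints M b a c d := by
  unfold PairSeparatesPoints at h ⊢
  rwa [pair_comm b a]

variable {M : Type u} [TopologicalSpace M]

theorem PairSeparatesPoints.two_le {a b c d : M} (h : PairSeparatesPoints M a b c d) :
    2 ≤ numComplementaryComponents M a b :=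
  Cardinal.two_le_iff.mpr ⟨_, _, (mk_eq_mk_iff_connectedComponentIn_eq h.1 h.2.1).not.mpr h.2.2⟩

theorem isOpen_pair_compl [T1Space M] (a b : M) : IsOpen ({a, b}ᶜ : Set M) :=
  (Set.toFinite {a, b}).isClosed.isOpen_compl

variable [T1Space M] [LocallyConnectedSpace M]

theorem mem_closure_connectedComponentIn_left {a b : M} (hab : a ≠ b)
    (hb : ¬ IsGlobalCutPoint M b) {x : M} (hx : x ∈ ({a, b}ᶜ : Set M)) :
    a ∈ closure (connectedComponentIn ({a, b}ᶜ : Set M) x) := by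
  by_contra ha
  have hpre : IsPreconnected ({b}ᶜ : Set M) := not_not.mp hb
  have hsub := hpre.subset_of_closure_inter_subset
    (isOpen_pair_compl a b).connectedComponentIn
    ⟨x, fun h => hx (Or.inr h), mem_connectedComponentIn hx⟩ (by
      rintro y ⟨hy, hyb⟩
      refine closure_connectedComponentIn_inter_subset hx ⟨hy, ?_⟩
      rintro (rfl | h)
      · exact ha hy
      · exact hyb h)
  exact ha (subset_closure (hsub hab))

theorem mem_closure_connectedComponentIn_right {a b : M} (hab : a ≠ b)
    (ha : ¬ IsGlobalCutPoint M a) {x : M} (hx : x ∈ ({a, b}ᶜ : Set M)) :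
    b ∈ closure (connectedComponentIn ({a, b}ᶜ : Set M) x) := by
  rw [pair_comm] at hx ⊢
  exact mem_closure_connectedComponentIn_left hab.symm ha hx

/-- A component of the complement of `{a, b}` missing `c` and `d` joins `a` to `b`. -/
theorem PairSeparatesPoints.mem_or_mem_connectedComponentIn {a b c d : M} (hab : a ≠ b)
    (ha : ¬ IsGlobalCutPoint M a) (hb : ¬ IsGlobalCutPoint M b)
    (h : PairSeparatesPoints M c d a b) {x : M} (hx : x ∈ ({a, b}ᶜ : Set M)) :
    c ∈ connectedComponentIn ({a, b}ᶜ : Set M) x ∨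
      d ∈ connectedComponentIn ({a, b}ᶜ : Set M) x := by
  by_contra! hcd
  have hc : c ∈ ({a, b}ᶜ : Set M) := by
    rintro (rfl | rfl)
    · exact h.1 (Or.inl rfl)
    · exact h.2.1 (Or.inl rfl)
  have hd : d ∈ ({a, b}ᶜ : Set M) := by
    rintro (rfl | rfl)
    · exact h.1 (Or.inr rfl)
    · exact h.2.1 (Or.inr rfl)
  refine h.2.2 (connectedComponentIn_eq ?_)
  refine isPreconnected_connectedComponentIn.closure.subset_connectedComponentIn
    (mem_closure_connectedComponentIn_left hab hb hx) ?_
    (mem_closure_connectedComponentIn_right hab ha hx)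
  rintro y hy (rfl | rfl)
  · exact hcd.1 (closure_connectedComponentIn_inter_subset hx ⟨hy, hc⟩)
  · exact hcd.2 (closure_connectedComponentIn_inter_subset hx ⟨hy, hd⟩)

theorem PairSeparatesPoints.mutuallySeparate {a b c d : M} (hab : a ≠ b)
    (ha : ¬ IsGlobalCutPoint M a) (hb : ¬ IsGlobalCutPoint M b)
    (hN : 2 ≤ numComplementaryComponents M a b) (h : PairSeparatesPoints M c d a b) :
    MutuallySeparate M a b c d := by
  have hc : c ∈ ({a, b}ᶜ : Set M) := by
    rintro (rfl | rfl)
    · exact h.1 (Or.inl rfl)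
    · exact h.2.1 (Or.inl rfl)
  have hd : d ∈ ({a, b}ᶜ : Set M) := by
    rintro (rfl | rfl)
    · exact h.1 (Or.inr rfl)
    · exact h.2.1 (Or.inr rfl)
  refine ⟨⟨hc, hd, fun heq => ?_⟩, h⟩
  obtain ⟨y, hy⟩ := (Cardinal.two_le_iff' (ConnectedComponents.mk
    (⟨c, hc⟩ : ({a, b}ᶜ : Set M)))).mp hN
  obtain ⟨⟨x, hx⟩, rfl⟩ := ConnectedComponents.surjective_coe y
  refine hy ((mk_eq_mk_iff_connectedComponentIn_eq hx hc).mpr ?_)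
  rcases h.mem_or_mem_connectedComponentIn hab ha hb hx with h' | h'
  · exact connectedComponentIn_eq h'
  · exact (connectedComponentIn_eq h').trans heq.symm

theorem MutuallySeparate.two_le_numComplementaryComponents {a b c d : M} (hab : a ≠ b)
    (hb : ¬ IsGlobalCutPoint M b) (h : MutuallySeparate M a b c d) :
    2 ≤ numComplementaryComponents M a c := by
  obtain ⟨⟨hc, hd, hcd⟩, ha', hb', hab'⟩ := h
  set U := connectedComponentIn ({a, b}ᶜ : Set M) c with hU
  set V := connectedComponentIn ({c, d}ᶜ : Set M) a with hV
  have hUo : IsOpen U := (isOpen_pair_compl a b).connectedComponentIn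
  have hVo : IsOpen V := (isOpen_pair_compl c d).connectedComponentIn
  have hdU : d ∉ U := fun hmem => hcd (connectedComponentIn_eq hmem)
  have hbV : b ∉ V := fun hmem => hab' (connectedComponentIn_eq hmem)
  have hclU : closure U ∩ {a, b}ᶜ ⊆ U := closure_connectedComponentIn_inter_subset hc
  have hclV : closure V ∩ {c, d}ᶜ ⊆ V := closure_connectedComponentIn_inter_subset ha'
  have hcl : closure (U ∩ V) ∩ {a, c}ᶜ ⊆ U ∩ V := by
    rintro y ⟨hy, hyac⟩
    have hyU := closure_mono inter_subset_left hy
    have hyV := closure_mono inter_subset_right hy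
    have hya : y ≠ a := fun h => hyac (Or.inl h)
    have hyc : y ≠ c := fun h => hyac (Or.inr h)
    have hyb : y ≠ b := by
      rintro rfl
      exact hbV (hclV ⟨hyV, hb'⟩)
    have hyd : y ≠ d := by
      rintro rfl
      exact hdU (hclU ⟨hyU, hd⟩)
    exact ⟨hclU ⟨hyU, by simp [hya, hyb]⟩, hclV ⟨hyV, by simp [hyc, hyd]⟩⟩
  obtain ⟨p, hpV, hpU⟩ := mem_closure_iff.mp (mem_closure_connectedComponentIn_left hab hb hc)
    V hVo (mem_connectedComponentIn ha')
  have hp : p ∈ ({a, c}ᶜ : Set M) := by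
    rintro (rfl | rfl)
    · exact connectedComponentIn_subset _ _ hpU (Or.inl rfl)
    · exact connectedComponentIn_subset _ _ hpV (Or.inl rfl)
  have hbac : b ∈ ({a, c}ᶜ : Set M) := by
    rintro (h | h)
    · exact hab h.symm
    · exact hb' (Or.inl h)
  refine PairSeparatesPoints.two_le (c := p) (d := b) ⟨hp, hbac, fun heq => ?_⟩
  have hsub : connectedComponentIn ({a, c}ᶜ : Set M) p ⊆ U ∩ V :=
    isPreconnected_connectedComponentIn.subset_of_closure_inter_subset (hUo.inter hVo)
      ⟨p, mem_connectedComponentIn hp, hpU, hpV⟩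
      fun y hy => hcl ⟨hy.1, connectedComponentIn_subset _ _ hy.2⟩
  exact hbV (hsub (heq ▸ mem_connectedComponentIn hbac)).2

end Pairs

/-- Every complementary component of `{c, d}` carries an end of the complement of `c`. -/
theorem numComplementaryComponents_le_of_valenceEq {M : Type u} [MetricSpace M] [CompactSpace M]
    [LocallyConnectedSpace M] {c d : M} {n : Cardinal.{u}} (hcd : c ≠ d)
    (hc : ¬ IsGlobalCutPoint M c) (hd : ¬ IsGlobalCutPoint M d) (hval : valenceEq c n) :
    numComplementaryComponents M c d ≤ n := by
  have hopen : IsOpen ({c}ᶜ : Set M) := isClosed_singleton.isOpen_compl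
  have : PreconnectedSpace ({c}ᶜ : Set M) := isPreconnected_iff_preconnectedSpace.mp (not_not.mp hc)
  have : LocallyConnectedSpace ({c}ᶜ : Set M) := hopen.locallyConnectedSpace
  have : LocallyCompactSpace ({c}ᶜ : Set M) := hopen.locallyCompactSpace
  obtain ⟨C, hC, hd0⟩ := exists_isExhaustion_mem_zero (⟨d, hcd.symm⟩ : ({c}ᶜ : Set M))
  rw [← hval C hC]
  have key : ∀ w : ({c, d}ᶜ : Set M), ∃ E : EndsSpace C,
      Subtype.val '' E.1 0 ⊆ connectedComponentIn ({c, d}ᶜ : Set M) w := by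
    intro w
    set W := connectedComponentIn ({c, d}ᶜ : Set M) w with hW
    have hWc : W ⊆ {c}ᶜ := fun y hy h => connectedComponentIn_subset _ _ hy (Or.inl h)
    let F₀ : Filter ({c}ᶜ : Set M) := Filter.comap Subtype.val (nhds c ⊓ Filter.principal W)
    have hF₀ : F₀.NeBot := by
      have : (nhds c ⊓ Filter.principal W).NeBot := mem_closure_iff_clusterPt.mp
        (mem_closure_connectedComponentIn_left hcd hd w.2)
      refine this.comap_of_range_mem (Filter.mem_inf_of_right ?_)
      rwa [Subtype.range_coe, Filter.mem_principal]
    have hCF : ∀ i, (C i)ᶜ ∈ Ultrafilter.of F₀ := fun i => by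
      refine Ultrafilter.of_le F₀ ⟨(Subtype.val '' C i)ᶜ, Filter.mem_inf_of_left ?_, ?_⟩
      · refine ((hC.isCompact i).image continuous_subtype_val).isClosed.isOpen_compl.mem_nhds ?_
        rintro ⟨y, -, hy⟩
        exact y.2 hy
      · exact fun y hy hyC => hy ⟨y, hyC, rfl⟩
    have hWF : Subtype.val ⁻¹' W ∈ Ultrafilter.of F₀ :=
      Ultrafilter.of_le F₀ ⟨W, Filter.mem_inf_of_right (Filter.mem_principal_self W), subset_rfl⟩
    obtain ⟨E, hE⟩ := exists_end_forall_mem hC ⟨_, hd0⟩ _ hCF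
    refine ⟨E, ?_⟩
    obtain ⟨x, -, hx⟩ := E.2.1 0
    obtain ⟨y, hyE, hyW⟩ := (Ultrafilter.of F₀).nonempty_of_mem (Filter.inter_mem (hE 0) hWF)
    have hpre : IsPreconnected (Subtype.val '' E.1 0) := by
      rw [hx]
      exact isPreconnected_connectedComponentIn.image _ continuous_subtype_val.continuousOn
    rw [hW, connectedComponentIn_eq hyW]
    refine hpre.subset_connectedComponentIn ⟨y, hyE, rfl⟩ ?_
    rintro _ ⟨z, hz, rfl⟩ (h | h)
    · exact z.2 h
    · rw [hx] at hz
      have hzd : z = ⟨d, hcd.symm⟩ := Subtype.ext h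
      exact connectedComponentIn_subset _ _ hz (hzd ▸ hd0)
  choose E hE using key
  refine Cardinal.mk_le_of_injective (f := fun k => E (Quot.out k)) fun k l hkl => ?_
  obtain ⟨x, hx, hx'⟩ := (E (Quot.out k)).2.1 0
  have hmem : x ∈ (E (Quot.out k)).1 0 := hx' ▸ mem_connectedComponentIn hx
  have hk := hE _ ⟨x, hmem, rfl⟩
  simp only at hkl
  rw [hkl] at hmem
  have hl := hE _ ⟨x, hmem, rfl⟩
  have heq := (mk_eq_mk_iff_connectedComponentIn_eq (Quot.out k).2 (Quot.out l).2).mpr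
    ((connectedComponentIn_eq hk).trans (connectedComponentIn_eq hl).symm)
  calc k = ConnectedComponents.mk (Quot.out k) := (Quot.out_eq k).symm
    _ = ConnectedComponents.mk (Quot.out l) := heq
    _ = l := Quot.out_eq l

/-- Let `M` be a Peano continuum and `G` a group acting on `M` as a
geometrically finite convergence group, and let `a, b, c, d ∈ M*(2)`.  If `a ∼ b` and the
pair `{c,d}` separates `{a,b}`, then `c ∼ d ∼ a ∼ b` (all four points are pairwise
`∼`-related), and the pairs `{a,b}` and `{c,d}` mutually separate. -/
theorem simRel_of_separates
    {G : Type*} {M : Type u} [Group G] [MetricSpace M] [CompactSpace M] [ConnectedSpace M]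
    [LocallyConnectedSpace M] [MulAction G M]
    (hcont : ContinuousActionOn G M)
    (hgf : IsGeometricallyFinite G M)
    (a b c d : M)
    (ha : a ∈ Mstar2 G M) (hb : b ∈ Mstar2 G M)
    (hc : c ∈ Mstar2 G M) (hd : d ∈ Mstar2 G M)
    (hab : SimRel a b)
    (hsep : PairSeparatesPoints M c d a b) :
    SimRel c d ∧ SimRel c a ∧ SimRel c b ∧ SimRel d a ∧ SimRel d b ∧ SimRel a b ∧
      MutuallySeparate M a b c d := by
  obtain ⟨-, ha, -⟩ := ha
  obtain ⟨-, hb, -⟩ := hb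
  obtain ⟨-, hc, hvc⟩ := hc
  obtain ⟨-, hd, hvd⟩ := hd
  have hne : a ≠ b := by
    rintro rfl
    exact hsep.2.2 rfl
  have hN : numComplementaryComponents M a b = 2 := hab.resolve_left hne
  obtain ⟨h₁, h₂⟩ := hsep.mutuallySeparate hne ha hb hN.ge
  have hcd : c ≠ d := by
    rintro rfl
    exact h₁.2.2 rfl
  have hca : c ≠ a := fun h => h₁.1 (Or.inl h)
  have hcb : c ≠ b := fun h => h₁.1 (Or.inr h)
  have hda : d ≠ a := fun h => h₁.2.1 (Or.inl h)
  have hdb : d ≠ b := fun h => h₁.2.1 (Or.inr h)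
  have le {x y : M} (hxy : x ≠ y) (hx : ¬ IsGlobalCutPoint M x) (hy : ¬ IsGlobalCutPoint M y)
      (hv : valenceEq x 2) (h : 2 ≤ numComplementaryComponents M x y) : SimRel x y :=
    Or.inr ((numComplementaryComponents_le_of_valenceEq hxy hx hy hv).antisymm h)
  have ge {x y z w : M} (hxy : x ≠ y) (hy : ¬ IsGlobalCutPoint M y)
      (h : PairSeparatesPoints M x y z w) (h' : PairSeparatesPoints M z w x y) :
      2 ≤ numComplementaryComponents M x z :=
    MutuallySeparate.two_le_numComplementaryComponents hxy hy ⟨h, h'⟩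
  exact ⟨le hcd hc hd hvc h₂.two_le,
    le hca hc ha hvc (ge hcd hd h₂ h₁),
    le hcb hc hb hvc (ge hcd hd h₂.symm h₁.comm),
    le hda hd ha hvd (ge hcd.symm hc h₂.comm h₁.symm),
    le hdb hd hb hvd (ge hcd.symm hc h₂.comm.symm h₁.symm.comm),
    hab, h₁, h₂⟩
end
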